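/- arXiv:2411.15578 — 3 statements merged into one kernel-verified Lean document; each statement's English description precedes it below -/
import Mathlib

section
/- Let Re(α) > 0. The Hölder operator H_α on L²(ℝ) is a holomorphic function of the continuous Cesàro operator 𝒞 (i.e., H_α = F(𝒞) for some F holomorphic in a neighborhood of the circle 𝕋+1) if and only if α is a positive integer. -/
open MeasureTheory Complex Filter

noncomputable section

/-- `L²(ℝ)` with complex values. -/
abbrev L2 : Type := MeasureTheory.Lp ℂ 2 (MeasureTheory.volume : MeasureTheory.Measure ℝ)

/-- `C` is the continuous Cesàro operator on `L²(ℝ)`: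
`(C f)(x) = ∫₀¹ f(ux) du`. -/
def IsCesaroOp (C : L2 →L[ℂ] L2) : Prop :=
  ∀ f : L2, ∀ᵐ x : ℝ ∂MeasureTheory.volume, C f x = ∫ u in Set.Ioo (0:ℝ) 1, f (u * x)

/-- `T` is the Hausdorff operator with kernel `K`:
`(T f)(x) = ∫_ℝ K(u) f(ux) du`. -/
def IsHausdorffOp (K : ℝ → ℂ) (T : L2 →L[ℂ] L2) : Prop :=
  ∀ f : L2, ∀ᵐ x : ℝ ∂MeasureTheory.volume, T f x = ∫ u : ℝ, K u * f (u * x)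

/-- The kernel `(1/Γ(α)) (log(1/u))^{α-1} χ_{(0,1)}(u)` of the Hölder operator `H_α`. -/
def holderKernel (α : ℂ) : ℝ → ℂ := fun u =>
  if u ∈ Set.Ioo (0:ℝ) 1 then (Complex.Gamma α)⁻¹ * ((Real.log u⁻¹ : ℝ) : ℂ) ^ (α - 1) else 0


lemma laplace_integrable (a r : ℂ) (ha : -1 < a.re) (hr : 0 < r.re) :
    IntegrableOn (fun t : ℝ => (t:ℂ) ^ a * cexp (-(r * t))) (Set.Ioi 0) := by
  have h := integrableOn_rpow_mul_exp_neg_mul_rpow (p := 1) (s := a.re) (b := r.re) ha one_pos hr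
  refine (integrable_norm_iff ?_).1 (h.congr ?_)
  · refine ContinuousOn.aestronglyMeasurable (fun t ht => ?_) measurableSet_Ioi
    have : (t:ℂ) ∈ slitPlane := Or.inl (by simpa using ht)
    refine ContinuousAt.continuousWithinAt ?_
    fun_prop (disch := assumption)
  · filter_upwards [ae_restrict_mem measurableSet_Ioi] with t ht
    rw [norm_mul, norm_cpow_eq_rpow_re_of_pos ht, norm_exp]
    simp

lemma laplace_diff (a : ℂ) (ha : 0 < a.re) :
    DifferentiableOn ℂ (fun r : ℂ => ∫ t : ℝ in Set.Ioi 0, (t:ℂ) ^ (a - 1) * cexp (-(r * t)))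
      {r | 0 < r.re} := by
  intro r hr
  have hr : 0 < r.re := hr
  refine DifferentiableAt.differentiableWithinAt ?_
  have hs : {z : ℂ | r.re / 2 < z.re} ∈ nhds r :=
    (isOpen_lt continuous_const continuous_re).mem_nhds (by simp; linarith)
  have := hasDerivAt_integral_of_dominated_loc_of_deriv_le
    (μ := volume.restrict (Set.Ioi (0:ℝ))) (x₀ := r)
    (F := fun r (t:ℝ) => (t:ℂ) ^ (a - 1) * cexp (-(r * t)))
    (F' := fun r (t:ℝ) => -((t:ℂ) ^ a * cexp (-(r * t))))
    (bound := fun t => t ^ a.re * Real.exp (-(r.re/2) * t ^ (1:ℝ)))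
    hs ?_ ?_ ?_ ?_ ?_ ?_
  · exact this.2.differentiableAt
  · filter_upwards [(isOpen_lt continuous_const continuous_re).mem_nhds hr] with z hz
    exact (laplace_integrable (a-1) z (by simpa using ha) hz).aestronglyMeasurable
  · exact (laplace_integrable (a-1) r (by simpa using ha) hr)
  · exact (laplace_integrable a r (by linarith) hr).neg.aestronglyMeasurable
  · filter_upwards [ae_restrict_mem measurableSet_Ioi] with t ht z hz
    have ht : 0 < t := ht
    have hz : r.re / 2 < z.re := hz
    rw [norm_neg, norm_mul, norm_cpow_eq_rpow_re_of_pos ht, norm_exp]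
    simp only [neg_re, mul_re, ofReal_re, ofReal_im, mul_zero, sub_zero, Real.rpow_one]
    gcongr
    nlinarith
  · exact integrableOn_rpow_mul_exp_neg_mul_rpow (by linarith) one_pos (by linarith)
  · filter_upwards [ae_restrict_mem measurableSet_Ioi] with t ht z hz
    have ht : 0 < t := ht
    have h1 : HasDerivAt (fun r : ℂ => -(r * t)) (-(1 * (t:ℂ))) z :=
      ((hasDerivAt_id z).mul_const (t:ℂ)).neg
    refine (h1.cexp.const_mul ((t:ℂ) ^ (a - 1))).congr_deriv ?_
    have : (t:ℂ) ^ a = (t:ℂ) ^ (a-1) * t := by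
      have ht' : (t:ℂ) ≠ 0 := by exact_mod_cast ht.ne'
      rw [cpow_sub _ _ ht', cpow_one]; field_simp
    rw [this]; ring

lemma one_div_slit {r : ℂ} (hr : 0 < r.re) : 1 / r ∈ slitPlane := by
  left
  have : r ≠ 0 := by rintro rfl; simp at hr
  rw [one_div, inv_re]
  have := normSq_pos.2 this
  positivity

lemma laplace (a r : ℂ) (ha : 0 < a.re) (hr : 0 < r.re) :
    ∫ t : ℝ in Set.Ioi 0, (t:ℂ) ^ (a - 1) * cexp (-(r * t)) = (1 / r) ^ a * Complex.Gamma a := by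
  have ho : IsOpen {r : ℂ | 0 < r.re} := isOpen_lt continuous_const continuous_re
  have h1 := (laplace_diff a ha).analyticOnNhd ho
  have h2 : AnalyticOnNhd ℂ (fun r : ℂ => (1 / r) ^ a * Complex.Gamma a) {r | 0 < r.re} := by
    refine DifferentiableOn.analyticOnNhd (fun r hr => ?_) ho
    have hr0 : r ≠ 0 := by rintro rfl; simp at hr
    have := one_div_slit hr
    refine DifferentiableAt.differentiableWithinAt ?_
    refine DifferentiableAt.mul_const ?_ _
    refine DifferentiableAt.cpow_const ?_ this
    exact (differentiableAt_const _).div differentiableAt_id hr0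
  have hc : IsPreconnected {r : ℂ | 0 < r.re} :=
    (convex_halfSpace_re_gt 0).isPreconnected
  refine h1.eqOn_of_preconnected_of_frequently_eq h2 hc (z₀ := 1) (by simp) ?_ hr
  have ht : Tendsto (fun x : ℝ => (x:ℂ)) (nhdsWithin 1 {1}ᶜ) (nhdsWithin 1 {1}ᶜ) := by
    refine tendsto_nhdsWithin_iff.2 ⟨?_, ?_⟩
    · exact (continuous_ofReal.tendsto' 1 1 (by simp)).mono_left nhdsWithin_le_nhds
    · filter_upwards [self_mem_nhdsWithin] with x hx
      simpa using hx
  refine ht.frequently (Eventually.frequently ?_)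
  filter_upwards [mem_nhdsWithin_of_mem_nhds (lt_mem_nhds (zero_lt_one (α := ℝ)))] with x hx
  exact integral_cpow_mul_exp_neg_mul_Ioi ha hx
lemma change_var (g : ℝ → ℂ) :
    ∫ u in Set.Ioo (0:ℝ) 1, g u = ∫ t in Set.Ioi (0:ℝ), (Real.exp (-t) : ℂ) * g (Real.exp (-t)) := by
  have him : Set.image (fun t : ℝ => Real.exp (-t)) (Set.Ioi 0) = Set.Ioo 0 1 := by
    ext u; constructor
    · rintro ⟨t, ht, rfl⟩
      exact ⟨Real.exp_pos _, by simpa using ht⟩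
    · rintro ⟨h0, h1⟩
      exact ⟨-Real.log u, by simpa using Real.log_neg h0 h1, by simp [Real.exp_log h0]⟩
  have := integral_image_eq_integral_abs_deriv_smul (s := Set.Ioi (0:ℝ))
    (f := fun t : ℝ => Real.exp (-t)) (f' := fun t => -Real.exp (-t)) measurableSet_Ioi
    (fun x _ => by
      have := ((hasDerivAt_neg x).exp).hasDerivWithinAt (s := Set.Ioi (0:ℝ))
      simpa using this)
    (fun x _ y _ h => by simpa using h) g
  rw [him] at this
  rw [this]
  refine setIntegral_congr_fun measurableSet_Ioi fun t _ => ?_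
  simp [abs_of_pos (Real.exp_pos _)]

lemma holder_integral (α : ℂ) (φ : ℝ → ℂ) : ∫ u : ℝ, holderKernel α u * φ u =
    ∫ u in Set.Ioo (0:ℝ) 1, (Complex.Gamma α)⁻¹ * ((Real.log u⁻¹ : ℝ) : ℂ) ^ (α - 1) * φ u := by
  rw [← integral_indicator measurableSet_Ioo]
  congr 1; ext u
  simp only [holderKernel, Set.indicator]
  split_ifs <;> simp

lemma holder_moment (α s : ℂ) (hα : 0 < α.re) (hs : -1 < s.re) :
    ∫ u : ℝ, holderKernel α u * (u:ℂ) ^ s = (1 / (s + 1)) ^ α := by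
  rw [holder_integral, change_var]
  have hG := Complex.Gamma_ne_zero_of_re_pos hα
  have h := laplace α (s + 1) hα (by simp; linarith)
  have : (1 / (s + 1)) ^ α = (Complex.Gamma α)⁻¹ * ((1 / (s + 1)) ^ α * Complex.Gamma α) := by
    field_simp
  rw [this, ← h, ← integral_const_mul]
  refine setIntegral_congr_fun measurableSet_Ioi fun t _ => ?_
  have h1 : (Real.log (Real.exp (-t))⁻¹) = t := by simp
  have h2 : ((Real.exp (-t) : ℝ) : ℂ) ^ s = cexp (-(s * t)) := by
    rw [cpow_def_of_ne_zero (by exact_mod_cast (Real.exp_pos _).ne'), ← ofReal_log (Real.exp_pos _).le,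
      Real.log_exp]
    push_cast; ring_nf
  have h3 : cexp (-((s+1) * t)) = cexp (-(s*t)) * ((Real.exp (-t) : ℝ) : ℂ) := by
    push_cast; rw [← Complex.exp_add]; ring_nf
  rw [h1, h2, h3]; ring

def fS (s : ℂ) : ℝ → ℂ := fun x => if x ∈ Set.Ioo (0:ℝ) 1 then (x:ℂ) ^ s else 0

lemma holder_fS (α s : ℂ) (hα : 0 < α.re) (hs : -1 < s.re) (x : ℝ) (hx : x ∈ Set.Ioo (0:ℝ) 1) :
    ∫ u : ℝ, holderKernel α u * fS s (u * x) = (1 / (s + 1)) ^ α * fS s x := by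
  rw [← holder_moment α s hα hs, ← integral_mul_const]
  congr 1; ext u
  by_cases hu : u ∈ Set.Ioo (0:ℝ) 1
  · have : u * x ∈ Set.Ioo (0:ℝ) 1 := ⟨mul_pos hu.1 hx.1, by nlinarith [hu.1, hu.2, hx.1, hx.2]⟩
    simp only [fS, this, hx, if_true]
    rw [ofReal_mul, mul_cpow_ofReal_nonneg hu.1.le hx.1.le]; ring
  · simp [holderKernel, hu]

lemma cesaro_fS (s : ℂ) (hs : -1 < s.re) (x : ℝ) :
    ∫ u in Set.Ioo (0:ℝ) 1, fS s (u * x) =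
      1 / (s + 1) * fS s x + 1 / (s + 1) * (if 1 ≤ x then ((x:ℂ))⁻¹ else 0) := by
  rcases le_or_gt x 0 with h | h
  · have : ∀ u ∈ Set.Ioo (0:ℝ) 1, fS s (u * x) = 0 := by
      intro u hu
      simp only [fS]
      rw [if_neg]
      rintro ⟨h1, _⟩
      nlinarith [hu.1]
    rw [setIntegral_congr_fun measurableSet_Ioo this]
    have h1 : ¬ (1 ≤ x) := by linarith
    simp [fS, h1, h.not_gt]
  rcases lt_or_ge x 1 with h1 | h1
  · have := holder_fS 1 s (by simp) hs x ⟨h, h1⟩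
    rw [holder_integral] at this
    simp only [Complex.Gamma_one, sub_self, cpow_zero, cpow_one, inv_one, one_mul] at this
    rw [this]; simp [h1.not_ge]
  · have h2 : ∫ y in (0:ℝ)..x, fS s y = 1 / (s + 1) := by
      rw [intervalIntegral.integral_of_le h.le]
      have := holder_moment 1 s (by simp) hs
      rw [holder_integral] at this
      simp only [Complex.Gamma_one, sub_self, cpow_zero, cpow_one, inv_one, one_mul] at this
      rw [← this, ← integral_indicator measurableSet_Ioo, ← integral_indicator measurableSet_Ioc]
      congr 1; ext u
      simp only [Set.indicator, fS]
      by_cases hu : u ∈ Set.Ioo (0:ℝ) 1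
      · have : u ∈ Set.Ioc 0 x := ⟨hu.1, hu.2.le.trans h1⟩
        simp [hu, this]
      · simp [hu]
    rw [← integral_Ioc_eq_integral_Ioo, ← intervalIntegral.integral_of_le zero_le_one,
      intervalIntegral.integral_comp_mul_right _ h.ne']
    simp only [zero_mul, one_mul, h2, h1, if_true]
    simp [fS, h1.not_gt]
    ring

lemma fS_meas (s : ℂ) : Measurable (fS s) := by
  unfold fS
  refine Measurable.ite measurableSet_Ioo ?_ measurable_const
  exact (measurable_ofReal.pow_const s)

lemma fS_sq (s : ℂ) (x : ℝ) :
    ‖fS s x‖ ^ 2 = (Set.Ioo (0:ℝ) 1).indicator (fun x => x ^ (2 * s.re)) x := by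
  simp only [fS, Set.indicator]
  split_ifs with h
  · rw [norm_cpow_eq_rpow_re_of_pos h.1, ← Real.rpow_natCast, ← Real.rpow_mul h.1.le]
    congr 1; push_cast; ring
  · simp

lemma fS_memLp (s : ℂ) (hs : -(1/2) < s.re) : MemLp (fS s) 2 (volume : Measure ℝ) := by
  rw [memLp_two_iff_integrable_sq_norm (fS_meas s).aestronglyMeasurable]
  simp_rw [fS_sq]
  rw [integrable_indicator_iff measurableSet_Ioo, intervalIntegral.integrableOn_Ioo_rpow_iff one_pos]
  linarith

lemma fS_int (s : ℂ) (hs : -(1/2) < s.re) : ∫ x, ‖fS s x‖ ^ 2 = 1 / (2 * s.re + 1) := by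
  simp_rw [fS_sq]
  rw [integral_indicator measurableSet_Ioo, ← integral_Ioc_eq_integral_Ioo,
    ← intervalIntegral.integral_of_le zero_le_one, integral_rpow (Or.inl (by linarith))]
  rw [Real.zero_rpow (by linarith)]; simp

def gT : ℝ → ℂ := fun x => if 1 ≤ x then ((x:ℂ))⁻¹ else 0

lemma gT_memLp : MemLp gT 2 (volume : Measure ℝ) := by
  have hm : Measurable gT := by
    unfold gT
    exact Measurable.ite measurableSet_Ici (measurable_ofReal.inv) measurable_const
  rw [memLp_two_iff_integrable_sq_norm hm.aestronglyMeasurable]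
  have : (fun x => ‖gT x‖ ^ 2) = (Set.Ici (1:ℝ)).indicator (fun x => x ^ (-2:ℝ)) := by
    ext x
    simp only [gT, Set.indicator, Set.mem_Ici]
    split_ifs with h
    · rw [Real.rpow_neg (by linarith)]; simp
    · simp
  rw [this, integrable_indicator_iff measurableSet_Ici, integrableOn_Ici_iff_integrableOn_Ioi]
  exact integrableOn_Ioi_rpow_of_lt (by norm_num) one_pos

lemma ae_scale {f g : ℝ → ℂ} (h : f =ᵐ[volume] g) {x : ℝ} (hx : x ≠ 0) :
    (fun u : ℝ => f (u * x)) =ᵐ[volume] fun u => g (u * x) := by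
  have := (Measure.quasiMeasurePreserving_smul (volume : Measure ℝ) hx).ae_eq_comp h
  simpa [Function.comp_def, mul_comm] using this

lemma ae_ne_zero : ∀ᵐ x : ℝ, x ≠ 0 := by
  simp [ae_iff]

lemma cesaro_apply (C : L2 →L[ℂ] L2) (hC : IsCesaroOp C) (s : ℂ) (hs : -(1/2) < s.re) :
    C ((fS_memLp s hs).toLp (fS s)) = (1 / (s + 1)) • ((fS_memLp s hs).toLp (fS s)) +
      (1 / (s + 1)) • (gT_memLp.toLp gT) := by
  have hf := (fS_memLp s hs).coeFn_toLp
  have hg := gT_memLp.coeFn_toLp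
  refine Lp.ext ?_
  filter_upwards [hC ((fS_memLp s hs).toLp (fS s)), hf, hg, ae_ne_zero,
    Lp.coeFn_add ((1 / (s + 1)) • ((fS_memLp s hs).toLp (fS s))) ((1 / (s + 1)) • (gT_memLp.toLp gT)),
    Lp.coeFn_smul (1 / (s + 1)) ((fS_memLp s hs).toLp (fS s)),
    Lp.coeFn_smul (1 / (s + 1)) (gT_memLp.toLp gT)] with x h1 h2 h3 h4 h5 h6 h7
  rw [h1, h5, Pi.add_apply, h6, h7, Pi.smul_apply, Pi.smul_apply, h2, h3, smul_eq_mul, smul_eq_mul,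
    integral_congr_ae (ae_restrict_of_ae (ae_scale hf h4)), cesaro_fS s (by linarith) x]
  rfl

lemma holder_inner (α : ℂ) (hα : 0 < α.re) (H : L2 →L[ℂ] L2) (hH : IsHausdorffOp (holderKernel α) H)
    (s : ℂ) (hs : -(1/2) < s.re) :
    inner ℂ ((fS_memLp s hs).toLp (fS s)) (H ((fS_memLp s hs).toLp (fS s))) =
      (1 / (s + 1)) ^ α * inner ℂ ((fS_memLp s hs).toLp (fS s)) ((fS_memLp s hs).toLp (fS s)) := by
  have hf := (fS_memLp s hs).coeFn_toLp
  rw [L2.inner_def, L2.inner_def, ← integral_const_mul]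
  refine integral_congr_ae ?_
  filter_upwards [hH ((fS_memLp s hs).toLp (fS s)), hf, ae_ne_zero] with x h1 h2 h4
  rw [h1, h2]
  have : ∀ᵐ u : ℝ, holderKernel α u * ((fS_memLp s hs).toLp (fS s)) (u * x) =
      holderKernel α u * fS s (u * x) := by
    filter_upwards [ae_scale hf h4] with u hu
    rw [hu]
  rw [integral_congr_ae this]
  by_cases hx : x ∈ Set.Ioo (0:ℝ) 1
  · rw [holder_fS α s hα (by linarith) x hx, ← smul_eq_mul, inner_smul_right]
  · have : fS s x = 0 := by simp only [fS, if_neg hx]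
    simp [this]

lemma fS_norm (s : ℂ) (hs : -(1/2) < s.re) :
    ‖(fS_memLp s hs).toLp (fS s)‖ ^ 2 = 1 / (2 * s.re + 1) := by
  rw [← fS_int s hs]
  have h := L2.inner_def (𝕜 := ℂ) ((fS_memLp s hs).toLp (fS s)) ((fS_memLp s hs).toLp (fS s))
  rw [inner_self_eq_norm_sq_to_K] at h
  have h2 : ∫ a, inner ℂ (((fS_memLp s hs).toLp (fS s)) a) (((fS_memLp s hs).toLp (fS s)) a) =
      ((∫ x, ‖fS s x‖ ^ 2 : ℝ) : ℂ) := by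
    rw [← integral_complex_ofReal]
    refine integral_congr_ae ?_
    filter_upwards [(fS_memLp s hs).coeFn_toLp] with x hx
    rw [hx, inner_self_eq_norm_sq_to_K]
    simp
  rw [h2] at h
  have h' : ((‖(fS_memLp s hs).toLp (fS s)‖ ^ 2 : ℝ) : ℂ) = ((∫ x, ‖fS s x‖ ^ 2 : ℝ) : ℂ) := by
    rw [← h]; push_cast; rfl
  exact ofReal_injective h'

lemma cfc_factor (C : L2 →L[ℂ] L2) (hN : IsStarNormal C)
    (hσ : spectrum ℂ C = Metric.sphere (1:ℂ) 1) (F : ℂ → ℂ) (U : Set ℂ) (hU : IsOpen U)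
    (hsU : Metric.sphere (1:ℂ) 1 ⊆ U) (hF : DifferentiableOn ℂ F U) (z : ℂ)
    (hz : z ∈ Metric.sphere (1:ℂ) 1) :
    ∃ G : L2 →L[ℂ] L2, ∀ f : L2, cfc F C f = F z • f + G (C f - z • f) := by
  have hUz : U ∈ nhds z := hU.mem_nhds (hsU hz)
  have hc : ContinuousOn (dslope F z) U :=
    (continuousOn_dslope hUz).2 ⟨hF.continuousOn, hF.differentiableAt hUz⟩
  have hc' : ContinuousOn (dslope F z) (spectrum ℂ C) := hσ ▸ hc.mono hsU
  refine ⟨cfc (dslope F z) C, fun f => ?_⟩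
  have h1 : F = fun w => F z + dslope F z w * (w - z) := by
    ext w
    have := sub_smul_dslope F z w
    rw [smul_eq_mul] at this
    linear_combination -this
  have h2 : cfc F C = algebraMap ℂ _ (F z) + cfc (dslope F z) C * (C - algebraMap ℂ _ z) := by
    conv_lhs => rw [h1]
    rw [cfc_const_add (F z) (fun w => dslope F z w * (w - z)) C (hc'.mul (by fun_prop)),
      cfc_mul (dslope F z) (fun w => w - z) C hc' (by fun_prop),
      cfc_sub (fun w => w) (fun _ => z) C, cfc_id' ℂ C, cfc_const z C]
  rw [h2]
  simp [Algebra.algebraMap_eq_smul_one]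

lemma symbol_eq (C : L2 →L[ℂ] L2) (hC : IsCesaroOp C) (hN : IsStarNormal C)
    (hσ : spectrum ℂ C = Metric.sphere (1:ℂ) 1)
    (α : ℂ) (hα : 0 < α.re)
    (H : L2 →L[ℂ] L2) (hH : IsHausdorffOp (holderKernel α) H)
    (F : ℂ → ℂ) (U : Set ℂ) (hU : IsOpen U)
    (hsU : Metric.sphere (1:ℂ) 1 ⊆ U) (hF : DifferentiableOn ℂ F U) (hFH : cfc F C = H) (t : ℝ) :
    F (1 / (1/2 + t * I)) = (1 / (1/2 + t * I)) ^ α := by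
  set r : ℂ := 1/2 + t * I with hr
  have hre : r.re = 1/2 := by simp [hr]
  have him : r.im = t := by simp [hr]
  have hr0 : r ≠ 0 := by intro h; rw [h] at hre; norm_num at hre
  have hz : 1 / r ∈ Metric.sphere (1:ℂ) 1 := by
    rw [mem_sphere_iff_norm]
    have : 1 / r - 1 = (1 - r) / r := by field_simp
    rw [this, norm_div, div_eq_one_iff_eq (norm_ne_zero_iff.2 hr0)]
    rw [← sq_eq_sq₀ (norm_nonneg _) (norm_nonneg _), ← normSq_eq_norm_sq, ← normSq_eq_norm_sq,
      normSq_apply, normSq_apply]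
    simp [hre]; norm_num
  obtain ⟨G, hG⟩ := cfc_factor C hN hσ F U hU hsU hF _ hz
  have key : ∀ ε : ℝ, 0 < ε → ‖(1 / (r + ε)) ^ α - F (1 / r)‖ ≤
      ‖G‖ * (‖1 / (r + ε) - 1 / r‖ + ‖1 / (r + ε)‖ * ‖gT_memLp.toLp gT‖ * Real.sqrt (2 * ε)) := by
    intro ε hε
    set s : ℂ := r + ε - 1 with hsd
    have hs : -(1/2) < s.re := by simp [hsd, hre]; linarith
    have hs1 : s + 1 = r + ε := by simp [hsd]
    set f := (fS_memLp s hs).toLp (fS s) with hf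
    have hn : ‖f‖ ^ 2 = 1 / (2 * ε) := by
      rw [hf, fS_norm s hs]; simp [hsd, hre]; ring
    have hfpos : 0 < ‖f‖ := by
      have : 0 < ‖f‖ ^ 2 := by rw [hn]; positivity
      exact lt_of_le_of_ne (norm_nonneg _) (fun h0 => by rw [← h0] at this; simp at this)
    have hsq : Real.sqrt (2 * ε) * ‖f‖ = 1 := by
      have : ‖f‖ = Real.sqrt (1 / (2 * ε)) := by rw [← hn, Real.sqrt_sq hfpos.le]
      rw [this, ← Real.sqrt_mul (by positivity)]
      rw [mul_one_div_cancel (by positivity), Real.sqrt_one]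
    have h1 := cesaro_apply C hC s hs
    have h2 := holder_inner α hα H hH s hs
    rw [← hf, hs1] at h1 h2
    rw [← hFH, hG f, h1, inner_add_right, inner_smul_right] at h2
    have h3 : ((1 / (r + ε)) ^ α - F (1 / r)) * inner ℂ f f =
        inner ℂ f (G ((1 / (r + ε)) • f + (1 / (r + ε)) • gT_memLp.toLp gT - (1 / r) • f)) := by
      linear_combination -h2
    have h4 : ‖(1 / (r + ε)) ^ α - F (1 / r)‖ * ‖f‖ ^ 2 ≤ ‖f‖ * (‖G‖ *
        (‖1 / (r + ε) - 1 / r‖ * ‖f‖ + ‖1 / (r + ε)‖ * ‖gT_memLp.toLp gT‖)) := by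
      have h5 : ‖((1 / (r + ε)) ^ α - F (1 / r)) * inner ℂ f f‖ =
          ‖(1 / (r + ε)) ^ α - F (1 / r)‖ * ‖f‖ ^ 2 := by
        rw [norm_mul, inner_self_eq_norm_sq_to_K]; simp
      rw [← h5, h3]
      refine (norm_inner_le_norm _ _).trans ?_
      gcongr
      refine (G.le_opNorm _).trans ?_
      gcongr
      have : (1 / (r + ε)) • f + (1 / (r + ε)) • gT_memLp.toLp gT - (1 / r) • f =
          (1 / (r + ε) - 1 / r) • f + (1 / (r + ε)) • gT_memLp.toLp gT := by
        rw [sub_smul]; abel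
      rw [this]
      refine (norm_add_le _ _).trans ?_
      rw [norm_smul, norm_smul]
    refine le_of_mul_le_mul_right (h4.trans (le_of_eq ?_)) (pow_pos hfpos 2)
    linear_combination (-‖f‖ * ‖G‖ * ‖1 / (r + ε)‖ * ‖gT_memLp.toLp gT‖) * hsq
  have hcont : ContinuousAt (fun ε : ℝ => 1 / (r + ε)) 0 := by
    refine ContinuousAt.div continuousAt_const (by fun_prop) (by simpa using hr0)
  have hsl : 1 / r ∈ slitPlane := one_div_slit (by rw [hre]; norm_num)
  have hL : Tendsto (fun ε : ℝ => ‖(1 / (r + ε)) ^ α - F (1 / r)‖) (nhdsWithin 0 (Set.Ioi 0))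
      (nhds ‖(1 / r) ^ α - F (1 / r)‖) := by
    have : ContinuousAt (fun ε : ℝ => ‖(1 / (r + ε)) ^ α - F (1 / r)‖) 0 := by
      refine ContinuousAt.norm (ContinuousAt.sub ?_ continuousAt_const)
      exact hcont.cpow continuousAt_const (by simpa using hsl)
    simpa using this.tendsto.mono_left nhdsWithin_le_nhds
  have hR : Tendsto (fun ε : ℝ => ‖G‖ * (‖1 / (r + ε) - 1 / r‖ +
      ‖1 / (r + ε)‖ * ‖gT_memLp.toLp gT‖ * Real.sqrt (2 * ε))) (nhdsWithin 0 (Set.Ioi 0))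
      (nhds 0) := by
    have : ContinuousAt (fun ε : ℝ => ‖G‖ * (‖1 / (r + ε) - 1 / r‖ +
      ‖1 / (r + ε)‖ * ‖gT_memLp.toLp gT‖ * Real.sqrt (2 * ε))) 0 := by
      refine continuousAt_const.mul ((hcont.sub continuousAt_const).norm.add ?_)
      exact (hcont.norm.mul continuousAt_const).mul (by fun_prop)
    have h := this.tendsto.mono_left (nhdsWithin_le_nhds (s := Set.Ioi 0))
    simpa using h
  have hle := le_of_tendsto_of_tendsto hL hR
    (by filter_upwards [self_mem_nhdsWithin] with ε hε using key ε hε)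
  have h0 := norm_le_zero_iff.1 hle
  exact (sub_eq_zero.1 h0).symm

lemma asymp (α : ℂ) (hα : 0 < α.re) (F : ℂ → ℂ) (hF : AnalyticAt ℂ F 0)
    (h : ∀ t : ℝ, F (1 / (1/2 + t * I)) = (1 / (1/2 + t * I)) ^ α) :
    ∃ n : ℕ, 0 < n ∧ α = (n : ℂ) := by
  set w : ℝ → ℂ := fun t => 1/2 + t * I with hw
  have hre : ∀ t, (w t).re = 1/2 := fun t => by simp [hw]
  have him : ∀ t, (w t).im = t := fun t => by simp [hw]
  have hw0 : ∀ t, w t ≠ 0 := fun t h0 => by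
    have := hre t; rw [h0] at this; norm_num at this
  have hnt : Tendsto (fun t => ‖w t‖) atTop atTop :=
    tendsto_atTop_mono (fun t => by
      have := abs_im_le_norm (w t); rw [him] at this; exact (le_abs_self t).trans this) tendsto_id
  have hconj : ∀ t, w (-t) = (starRingEnd ℂ) (w t) := fun t => by
    apply Complex.ext <;> simp [hre, him]
  have hnneg : ∀ t, ‖w (-t)‖ = ‖w t‖ := fun t => by rw [hconj, norm_conj]
  have hz : Tendsto (fun t => 1 / w t) atTop (nhds 0) := by
    rw [tendsto_zero_iff_norm_tendsto_zero]
    simpa [Pi.inv_def] using hnt.inv_tendsto_atTop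
  have hz' : Tendsto (fun t => 1 / w (-t)) atTop (nhds 0) := by
    rw [tendsto_zero_iff_norm_tendsto_zero]
    simpa [hnneg, Pi.inv_def] using hnt.inv_tendsto_atTop
  have hne : ∀ t, (1 / w t) ^ α ≠ 0 := fun t => by
    rw [Ne, cpow_eq_zero_iff]; simp [hw0 t]
  obtain ⟨n, g, hg, hg0, hn⟩ := hF.exists_eventuallyEq_pow_smul_nonzero_iff.2 (by
    intro h0
    obtain ⟨t, ht⟩ := (hz.eventually h0).exists
    exact hne t ((h t).symm.trans ht))
  -- log of the modulus
  have hlog : ∀ t, F (1 / w t) = (1 / w t - 0) ^ n • g (1 / w t) →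
      Real.log ‖g (1 / w t)‖ = -(α.re - n) * Real.log ‖w t‖ + (w t).arg * α.im := by
    intro t ht
    rw [h t, sub_zero, smul_eq_mul] at ht
    have hgt : g (1 / w t) ≠ 0 := fun h0 => hne t (by rw [show w t = 1/2 + t * I from rfl, ht, h0, mul_zero])
    have h1 := congrArg (fun z : ℂ => Real.log ‖z‖) ht
    have hinv : 1 / (1/2 + t * I : ℂ) ≠ 0 := one_div_ne_zero (hw0 t)
    have hpos : 0 < ‖w t‖ := norm_pos_iff.2 (hw0 t)
    have harg : (1 / w t).arg = -(w t).arg := by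
      rw [one_div, arg_inv, if_neg]
      intro h0
      have := (arg_eq_pi_iff.1 h0).1
      rw [hre] at this; norm_num at this
    beta_reduce at h1
    rw [norm_cpow_of_ne_zero hinv, norm_mul, norm_pow, Real.log_mul (pow_ne_zero _ (norm_ne_zero_iff.2 (one_div_ne_zero (hw0 t)))) (norm_ne_zero_iff.2 hgt),
      Real.log_div (by
        have : 0 < ‖1 / (1/2 + t * I : ℂ)‖ := norm_pos_iff.2 hinv
        positivity) (Real.exp_pos _).ne', Real.log_exp, Real.log_rpow (norm_pos_iff.2 hinv),
        Real.log_pow, show (1/2 + t * I : ℂ) = w t from rfl, harg, norm_div, norm_one, one_div, Real.log_inv] at h1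
    linear_combination -h1
  have hgl : ∀ u : ℝ → ℂ, Tendsto u atTop (nhds 0) →
      Tendsto (fun t => Real.log ‖g (u t)‖) atTop (nhds (Real.log ‖g 0‖)) := fun u hu =>
    ((hg.continuousAt.tendsto.comp hu).norm).log (by simpa using hg0)
  have hA := (hgl _ hz).congr' ((hz.eventually hn).mono fun t ht => hlog t ht)
  have hB := (hgl _ hz').congr' ((hz'.eventually hn).mono fun t ht => hlog (-t) ht)
  have hargneg : ∀ t, (w (-t)).arg = -(w t).arg := fun t => by
    rw [hconj, arg_conj, if_neg]
    intro h0
    have := (arg_eq_pi_iff.1 h0).1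
    rw [hre] at this; norm_num at this
  have hD : Tendsto (fun t => 2 * α.im * (w t).arg) atTop (nhds 0) := by
    have := hA.sub hB
    rw [sub_self] at this
    refine this.congr fun t => ?_
    rw [hargneg, hnneg]; ring
  have hargl : ∀ t, 1 ≤ t → Real.pi / 4 ≤ (w t).arg := by
    intro t ht
    rw [arg_of_re_nonneg (by rw [hre]; norm_num), him]
    rw [Real.le_arcsin_iff_sin_le' ⟨by linarith [Real.pi_pos], by linarith [Real.pi_pos]⟩,
      Real.sin_pi_div_four, div_le_div_iff₀ two_pos (norm_pos_iff.2 (hw0 t))]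
    refine abs_le_of_sq_le_sq' ?_ (by linarith) |>.2
    rw [mul_pow, Real.sq_sqrt (by norm_num), ← normSq_eq_norm_sq, normSq_apply, hre, him]
    nlinarith
  have him0 : α.im = 0 := by
    by_contra hne0
    have h1 : Tendsto (fun t => (w t).arg) atTop (nhds 0) := by
      have := hD.const_mul (2 * α.im)⁻¹
      rw [mul_zero] at this
      refine this.congr fun t => ?_
      field_simp
    have := ge_of_tendsto h1 ((eventually_ge_atTop 1).mono hargl)
    linarith [Real.pi_pos]
  have hren : α.re = n := by
    by_contra hne0
    have hne1 : α.re - n ≠ 0 := sub_ne_zero.2 hne0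
    simp only [him0, mul_zero, add_zero] at hA
    have h1 := hA.const_mul (-(α.re - n))⁻¹
    have h2 : Tendsto (fun t => Real.log ‖w t‖) atTop atTop := Real.tendsto_log_atTop.comp hnt
    refine not_tendsto_nhds_of_tendsto_atTop h2 _ (h1.congr fun t => ?_)
    have : (-(α.re - n)) ≠ 0 := neg_ne_zero.2 hne1
    field_simp
  refine ⟨n, ?_, Complex.ext (by simp [hren]) (by simp [him0])⟩
  rw [hren] at hα
  exact_mod_cast hα

/-- Pointwise Cesàro mean. -/
def avg (f : ℝ → ℂ) : ℝ → ℂ := fun x => ∫ u in Set.Ioo (0:ℝ) 1, f (u * x)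

lemma avg_cont {f : ℝ → ℂ} (hf : Continuous f) : Continuous (avg f) := by
  unfold avg
  simp_rw [← integral_Icc_eq_integral_Ioo]
  exact continuous_parametric_integral_of_continuous
    (f := fun x u => f (u * x)) (by simp only [Function.uncurry_def]; fun_prop) isCompact_Icc

lemma avg_bdd {f : ℝ → ℂ} {M : ℝ} (hM : ∀ x, ‖f x‖ ≤ M) (x : ℝ) : ‖avg f x‖ ≤ M := by
  unfold avg
  have := norm_setIntegral_le_of_norm_le_const (μ := volume) (s := Set.Ioo (0:ℝ) 1)
    (f := fun u => f (u * x)) (C := M) (by simp) (fun u _ => hM _)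
  simpa using this

lemma avg_eq (f : ℝ → ℂ) (u x : ℝ) (hu : 0 < u) :
    (u : ℂ) * avg f (u * x) = ∫ v in (0:ℝ)..u, f (v * x) := by
  have h := intervalIntegral.integral_comp_mul_right (fun v => f (v * x)) hu.ne' (a := 0) (b := 1)
  simp only [zero_mul, one_mul] at h
  have hu' : (u:ℂ) ≠ 0 := by exact_mod_cast hu.ne'
  unfold avg
  rw [← integral_Ioc_eq_integral_Ioo, ← intervalIntegral.integral_of_le zero_le_one]
  simp_rw [← mul_assoc]
  rw [h]; simp [hu']

lemma log_int (n : ℕ) : IntegrableOn (fun u : ℝ => (Real.log u⁻¹) ^ n) (Set.Ioo 0 1) := by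
  have him : Set.image (fun t : ℝ => Real.exp (-t)) (Set.Ioi 0) = Set.Ioo 0 1 := by
    ext u; constructor
    · rintro ⟨t, ht, rfl⟩
      exact ⟨Real.exp_pos _, by simpa using ht⟩
    · rintro ⟨h0, h1⟩
      exact ⟨-Real.log u, by simpa using Real.log_neg h0 h1, by simp [Real.exp_log h0]⟩
  have := integrableOn_image_iff_integrableOn_abs_deriv_smul (s := Set.Ioi (0:ℝ))
    (f := fun t : ℝ => Real.exp (-t)) (f' := fun t => -Real.exp (-t)) measurableSet_Ioi
    (fun x _ => by
      have := ((hasDerivAt_neg x).exp).hasDerivWithinAt (s := Set.Ioi (0:ℝ))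
      simpa using this)
    (fun x _ y _ h => by simpa using h) (fun u : ℝ => (Real.log u⁻¹) ^ n)
  rw [him] at this
  rw [this]
  have h := integrableOn_rpow_mul_exp_neg_mul_rpow (p := 1) (s := n) (b := 1)
    (by have : (0:ℝ) ≤ n := n.cast_nonneg
        linarith) one_pos one_pos
  refine h.congr_fun (fun t _ => ?_) measurableSet_Ioi
  simp [abs_of_pos (Real.exp_pos _), mul_comm]

/-- `n`-th Hölder mean with kernel `log(1/u)^n / n!`. -/
def hol (n : ℕ) (f : ℝ → ℂ) (x : ℝ) : ℂ :=
  ∫ u in Set.Ioo (0:ℝ) 1, (((Real.log u⁻¹) ^ n / n.factorial : ℝ) : ℂ) * f (u * x)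

lemma hol_integrable (n : ℕ) {f : ℝ → ℂ} (hf : Continuous f) {M : ℝ} (hM : ∀ x, ‖f x‖ ≤ M) (x : ℝ) :
    IntegrableOn (fun u : ℝ => (((Real.log u⁻¹) ^ n / n.factorial : ℝ) : ℂ) * f (u * x))
      (Set.Ioo 0 1) := by
  refine Integrable.mul_bdd (c := M) ((log_int n).div_const _).ofReal ?_ ?_
  · exact (by fun_prop : Continuous fun u : ℝ => f (u * x)).aestronglyMeasurable
  · exact Eventually.of_forall fun u => hM _

lemma hol_succ (n : ℕ) {f : ℝ → ℂ} (hf : Continuous f) {M : ℝ} (hM : ∀ x, ‖f x‖ ≤ M) (x : ℝ) :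
    hol (n + 1) f x = hol n (avg f) x := by
  have hi1 := hol_integrable (n+1) hf hM x
  have hi2 := hol_integrable n (avg_cont hf) (avg_bdd hM) x
  unfold hol
  rw [← sub_eq_zero, ← integral_sub hi1 hi2, ← integral_Ioc_eq_integral_Ioo,
    ← intervalIntegral.integral_of_le zero_le_one]
  have hcf : Continuous fun v : ℝ => f (v * x) := by fun_prop
  rw [intervalIntegral.integral_eq_sub_of_hasDerivAt_of_tendsto (fa := 0) (fb := 0)
    (f := fun u : ℝ => (((Real.log u⁻¹) ^ (n+1) / (n+1).factorial : ℝ) : ℂ) *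
      ∫ v in (0:ℝ)..u, f (v * x)) zero_lt_one ?_ ?_ ?_ ?_, sub_zero]
  · intro u hu
    have hd1 : HasDerivAt (fun u : ℝ => (Real.log u⁻¹) ^ (n+1) / (n+1).factorial)
        (-((Real.log u⁻¹) ^ n / n.factorial) / u) u := by
      have h1 : HasDerivAt (fun u : ℝ => Real.log u⁻¹) (-u⁻¹) u := by
        simp_rw [Real.log_inv]
        exact (Real.hasDerivAt_log hu.1.ne').neg
      refine ((h1.pow (n+1)).div_const _).congr_deriv ?_
      rw [Nat.factorial_succ]
      have : (n.factorial : ℝ) ≠ 0 := by positivity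
      have : u ≠ 0 := hu.1.ne'
      push_cast
      field_simp
    have hd2 : HasDerivAt (fun u : ℝ => ∫ v in (0:ℝ)..u, f (v * x)) (f (u * x)) u :=
      intervalIntegral.integral_hasDerivAt_right (hcf.intervalIntegrable _ _)
        hcf.stronglyMeasurable.stronglyMeasurableAtFilter hcf.continuousAt
    refine (hd1.ofReal_comp.mul hd2).congr_deriv ?_
    rw [← avg_eq f u x hu.1]
    have hu' : (u:ℂ) ≠ 0 := by exact_mod_cast hu.1.ne'
    push_cast
    field_simp
    ring
  · rw [intervalIntegrable_iff_integrableOn_Ioo_of_le zero_le_one]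
    exact hi1.sub hi2
  · -- limit at `0`
    have hl : Tendsto (fun u : ℝ => u * (Real.log u⁻¹) ^ (n+1)) (nhdsWithin 0 (Set.Ioi 0)) (nhds 0) := by
      have h1 := (Real.tendsto_pow_mul_exp_neg_atTop_nhds_zero (n+1)).comp
        (tendsto_neg_atBot_atTop.comp Real.tendsto_log_nhdsGT_zero)
      refine h1.congr' ?_
      filter_upwards [self_mem_nhdsWithin] with u hu
      have hu : 0 < u := hu
      simp [Real.exp_log hu, mul_comm]
    have hl2 : Tendsto (fun u : ℝ => |u * (Real.log u⁻¹) ^ (n+1)| * (M / (n+1).factorial))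
        (nhdsWithin 0 (Set.Ioi 0)) (nhds 0) := by
      simpa using hl.abs.mul_const (M / (n+1).factorial)
    refine squeeze_zero_norm' ?_ hl2
    filter_upwards [self_mem_nhdsWithin] with u hu
    have hu : 0 < u := hu
    rw [← avg_eq f u x hu, norm_mul, norm_mul, norm_real, norm_real, norm_div, Real.norm_natCast,
      Real.norm_eq_abs, abs_mul]
    have := avg_bdd hM (u * x)
    calc _ = |u| * |Real.log u⁻¹ ^ (n + 1)| / (n+1).factorial * ‖avg f (u * x)‖ := by
          rw [Real.norm_eq_abs]; ring
      _ ≤ |u| * |Real.log u⁻¹ ^ (n + 1)| / (n+1).factorial * M := by gcongr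
      _ = _ := by ring
  · -- limit at `1`
    have : ContinuousAt (fun u : ℝ => (((Real.log u⁻¹) ^ (n+1) / (n+1).factorial : ℝ) : ℂ) *
      ∫ v in (0:ℝ)..u, f (v * x)) 1 := by
      refine ContinuousAt.mul ?_ ?_
      · refine continuous_ofReal.continuousAt.comp ?_
        refine ContinuousAt.div_const (ContinuousAt.pow ?_ _) _
        exact (continuousAt_inv₀ one_ne_zero).log (by simp)
      · exact (intervalIntegral.continuous_primitive
          (fun a b => hcf.intervalIntegrable a b) 0).continuousAt
    have h := this.tendsto.mono_left (nhdsWithin_le_nhds (s := Set.Iio 1))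
    simpa using h

lemma hol_eq (n : ℕ) : ∀ {f : ℝ → ℂ} (_ : Continuous f) {M : ℝ} (_ : ∀ x, ‖f x‖ ≤ M) (x : ℝ),
    hol n f x = avg^[n+1] f x := by
  induction n with
  | zero => intro f hf M hM x; simp [hol, avg]
  | succ n ih =>
    intro f hf M hM x
    rw [hol_succ n hf hM, ih (avg_cont hf) (avg_bdd hM), ← Function.iterate_succ_apply]

lemma pow_ae (C : L2 →L[ℂ] L2) (hC : IsCesaroOp C) (f : L2) (φ : ℝ → ℂ) (h : f =ᵐ[volume] φ)
    (n : ℕ) : (C ^ n) f =ᵐ[volume] avg^[n] φ := by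
  induction n with
  | zero => simpa using h
  | succ n ih =>
    rw [pow_succ', Function.iterate_succ_apply']
    filter_upwards [hC ((C ^ n) f), ae_ne_zero] with x hx h0
    rw [mul_apply_eq_comp, hx, integral_congr_ae (ae_restrict_of_ae (ae_scale ih h0))]
    rfl

lemma holder_nat (C : L2 →L[ℂ] L2) (hC : IsCesaroOp C) (n : ℕ)
    (H : L2 →L[ℂ] L2) (hH : IsHausdorffOp (holderKernel ((n + 1 : ℕ) : ℂ)) H) : C ^ (n + 1) = H := by
  have hd := Lp.boundedContinuousFunction_dense ℂ (volume : Measure ℝ) (p := 2) (by simp)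
  have : ((C ^ (n+1) : L2 →L[ℂ] L2) : L2 → L2) = H := by
    refine Continuous.ext_on hd (C ^ (n+1)).continuous H.continuous ?_
    intro f hf
    obtain ⟨φ, hφ⟩ := hf
    have hfφ : f =ᵐ[volume] φ := by
      have := congrArg (fun g : ℝ →ₘ[volume] ℂ => (g : ℝ → ℂ)) hφ
      have h2 := φ.toContinuousMap.coeFn_toAEEqFun (volume : Measure ℝ)
      filter_upwards [h2] with x hx
      exact (congrFun this x).symm.trans hx
    refine Lp.ext ?_
    filter_upwards [pow_ae C hC f φ hfφ (n+1), hH f, ae_ne_zero] with x h1 h2 h3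
    rw [h1, h2, ← hol_eq n φ.continuous (fun x => φ.norm_coe_le_norm x) x]
    have : ∀ᵐ u : ℝ, holderKernel ((n + 1 : ℕ) : ℂ) u * f (u * x) =
        holderKernel ((n + 1 : ℕ) : ℂ) u * φ (u * x) := by
      filter_upwards [ae_scale hfφ h3] with u hu
      rw [hu]
    rw [integral_congr_ae this, holder_integral]
    unfold hol
    refine setIntegral_congr_fun measurableSet_Ioo fun u hu => ?_
    push_cast
    rw [Complex.Gamma_nat_eq_factorial, add_sub_cancel_right, cpow_natCast]
    ring
  exact DFunLike.coe_injective this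

/-- For `Re α > 0`, the Hölder operator `H_α` on `L²(ℝ)` is a
holomorphic function of the (normal) Cesàro operator `C` — i.e. `H_α = F(C)` for
some `F` holomorphic in a neighborhood of the circle `𝕋+1` (the functional calculus
of the normal operator `C` being realized as `cfc F C`) — if and only if `α` is a
positive integer. -/
theorem stmt8
    (C : L2 →L[ℂ] L2) (hC : IsCesaroOp C) (hN : IsStarNormal C)
    (hσ : spectrum ℂ C = Metric.sphere (1:ℂ) 1)
    (α : ℂ) (hα : 0 < α.re)
    (H : L2 →L[ℂ] L2) (hH : IsHausdorffOp (holderKernel α) H) :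
    (∃ (F : ℂ → ℂ) (U : Set ℂ), IsOpen U ∧ Metric.sphere (1:ℂ) 1 ⊆ U ∧
        DifferentiableOn ℂ F U ∧ cfc F C = H) ↔
      ∃ n : ℕ, 0 < n ∧ α = (n : ℂ) := by
  constructor
  · rintro ⟨F, U, hU, hsU, hF, hFH⟩
    have h0 : (0:ℂ) ∈ U := hsU (by simp)
    exact asymp α hα F (hF.analyticAt (hU.mem_nhds h0))
      (symbol_eq C hC hN hσ α hα H hH F U hU hsU hF hFH)
  · rintro ⟨n, hn, rfl⟩
    obtain ⟨m, rfl⟩ : ∃ m, n = m + 1 := ⟨n - 1, by omega⟩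
    refine ⟨fun z => z ^ (m + 1), Set.univ, isOpen_univ, Set.subset_univ _, by fun_prop, ?_⟩
    rw [cfc_pow_id C (m + 1)]
    exact holder_nat C hC m H hH
end
end

section
/- Setting H_0 := I, the family (H_α)_{Re(α)>0} of Hölder operators on L²(ℝ) is a semigroup (H_α H_β = H_{α+β}) which is holomorphic in the open right half-plane {α : Re(α) > 0}; its generator is a normal operator whose spectrum lies in the half-plane {z : Re(z) ≤ log 2}, and the restriction of this semigroup to the real semiaxis {α ≥ 0} is a positivity-preserving C₀-semigroup. -/
open MeasureTheory Complex Filter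

noncomputable section

/-- The (generally unbounded, partially defined) operator `A` is the infinitesimal
generator of the one-parameter family `T` of bounded operators: its domain consists
exactly of those `f` for which the limit of `t⁻¹ (T t f - f)` as `t → 0⁺` exists,
and `A f` is that limit. -/
def IsGeneratorOf (T : ℝ → (L2 →L[ℂ] L2)) (A : L2 →ₗ.[ℂ] L2) : Prop :=
  ∀ f : L2,
    (f ∈ A.domain ↔ ∃ g : L2,
      Filter.Tendsto (fun t : ℝ => (t : ℂ)⁻¹ • (T t f - f))
        (nhdsWithin 0 (Set.Ioi 0)) (nhds g)) ∧
    ∀ hf : f ∈ A.domain,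
      Filter.Tendsto (fun t : ℝ => (t : ℂ)⁻¹ • (T t f - f))
        (nhdsWithin 0 (Set.Ioi 0)) (nhds (A ⟨f, hf⟩))

/-- `R` is the resolvent `(z I - A)⁻¹` of the partially defined operator `A`. -/
def IsResolventOf (A : L2 →ₗ.[ℂ] L2) (z : ℂ) (R : L2 →L[ℂ] L2) : Prop :=
  (∀ f : L2, ∃ hf : R f ∈ A.domain, z • (R f) - A ⟨R f, hf⟩ = f) ∧
  (∀ f : L2, ∀ hf : f ∈ A.domain, R (z • f - A ⟨f, hf⟩) = f)


section AbsRep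
variable {E : Type*} [NormedAddCommGroup E] [InnerProductSpace ℂ E] [CompleteSpace E]

/-- A weakly measurable one-parameter unitary group. -/
structure UGrp (U : ℝ → E →L[ℂ] E) : Prop where
  zero : U 0 = 1
  add : ∀ s t, U (s + t) = U s * U t
  norm : ∀ s f, ‖U s f‖ = ‖f‖
  adj : ∀ s f g, inner ℂ (U s f) g = inner ℂ f (U (-s) g)
  meas : ∀ f g, StronglyMeasurable (fun s => inner ℂ g (U s f))

/-- `T = ∫ k(s) U_s ds` weakly. -/
def WRep (U : ℝ → E →L[ℂ] E) (k : ℝ → ℂ) (T : E →L[ℂ] E) : Prop :=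
  ∀ f g : E, inner ℂ g (T f) = ∫ s, k s * inner ℂ g (U s f)

variable {U : ℝ → E →L[ℂ] E} (hU : UGrp U)

theorem UGrp.bound (hU : UGrp U) (s : ℝ) (f g : E) : ‖(inner ℂ g (U s f) : ℂ)‖ ≤ ‖g‖ * ‖f‖ := by
  have := norm_inner_le_norm (𝕜 := ℂ) g (U s f)
  rwa [hU.norm] at this

theorem UGrp.integrable (hU : UGrp U) {k : ℝ → ℂ} (hk : Integrable k) (f g : E) :
    Integrable (fun s => k s * inner ℂ g (U s f)) := by
  refine hk.mul_bdd (c := ‖g‖ * ‖f‖) (hU.meas f g).aestronglyMeasurable ?_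
  exact ae_of_all _ fun s => hU.bound s f g

theorem WRep.norm_le (hU : UGrp U) {k : ℝ → ℂ} {T : E →L[ℂ] E} (hk : Integrable k)
    (hT : WRep U k T) : ‖T‖ ≤ ∫ s, ‖k s‖ := by
  have h0 : 0 ≤ ∫ s, ‖k s‖ := integral_nonneg fun s => norm_nonneg _
  refine T.opNorm_le_bound h0 fun f => ?_
  have key : ‖(inner ℂ (T f) (T f) : ℂ)‖ ≤ (∫ s, ‖k s‖) * (‖T f‖ * ‖f‖) := by
    rw [hT f (T f), ← integral_mul_const]
    refine norm_integral_le_of_norm_le (hk.norm.mul_const _) (ae_of_all _ fun s => ?_)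
    rw [norm_mul]
    exact mul_le_mul_of_nonneg_left (hU.bound s f _) (norm_nonneg _)
  rw [inner_self_eq_norm_sq_to_K] at key
  have k2 : ‖T f‖ ^ 2 ≤ (∫ s, ‖k s‖) * (‖T f‖ * ‖f‖) := by
    simpa using key
  rcases (norm_nonneg (T f)).eq_or_lt with h | h
  · rw [← h]; positivity
  · nlinarith

theorem WRep.sub (hU : UGrp U) {k l : ℝ → ℂ} {T S : E →L[ℂ] E} (hk : Integrable k) (hl : Integrable l)
    (hT : WRep U k T) (hS : WRep U l S) : WRep U (fun s => k s - l s) (T - S) := by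
  intro f g
  simp only [sub_apply, inner_sub_right, sub_mul]
  rw [hT, hS, integral_sub (hU.integrable hk f g) (hU.integrable hl f g)]

theorem WRep.smul {k : ℝ → ℂ} {T : E →L[ℂ] E} (c : ℂ)
    (hT : WRep U k T) : WRep U (fun s => c * k s) (c • T) := by
  intro f g
  simp only [smul_apply, inner_smul_right, mul_assoc]
  rw [hT, integral_const_mul]

theorem WRep.congr {k l : ℝ → ℂ} {T : E →L[ℂ] E} (h : k =ᵐ[volume] l)
    (hT : WRep U k T) : WRep U l T := by
  intro f g
  rw [hT]
  refine integral_congr_ae ?_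
  filter_upwards [h] with s hs
  rw [hs]

theorem WRep.unique {k : ℝ → ℂ} {T S : E →L[ℂ] E} (hT : WRep U k T) (hS : WRep U k S) : T = S := by
  ext f
  refine ext_inner_left ℂ fun g => ?_
  rw [hT, hS]

theorem WRep.commU (hU : UGrp U) {k : ℝ → ℂ} {T : E →L[ℂ] E} (hT : WRep U k T) (r : ℝ) :
    Commute (U r) T := by
  ext f
  refine ext_inner_left ℂ fun g => ?_
  simp only [mul_apply_eq_comp]
  have h1 : ∀ x y : E, (inner ℂ x (U r y) : ℂ) = inner ℂ (U (-r) x) y := by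
    intro x y; rw [hU.adj, neg_neg]
  rw [h1, hT, hT]
  congr 1; ext s; rw [← h1, ← mul_apply_eq_comp, ← mul_apply_eq_comp, ← hU.add, ← hU.add, add_comm]

theorem WRep.comm {k : ℝ → ℂ} {T S : E →L[ℂ] E} (hT : WRep U k T)
    (hS : ∀ r, Commute (U r) S) : Commute S T := by
  ext f
  refine ext_inner_left ℂ fun g => ?_
  simp only [mul_apply_eq_comp]
  rw [← ContinuousLinearMap.adjoint_inner_left, hT, hT]
  congr 1; ext s
  rw [ContinuousLinearMap.adjoint_inner_left, ← mul_apply_eq_comp S, ← (hS s).eq]; rfl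

theorem UGrp.comm_adj (hU : UGrp U) {S : E →L[ℂ] E} (hS : ∀ r, Commute (U r) S) (r : ℝ) :
    Commute (U r) (ContinuousLinearMap.adjoint S) := by
  ext f
  refine ext_inner_left ℂ fun g => ?_
  have h1 : ∀ x y : E, (inner ℂ x (U r y) : ℂ) = inner ℂ (U (-r) x) y := by
    intro x y; rw [hU.adj, neg_neg]
  simp only [mul_apply_eq_comp]
  rw [h1, ContinuousLinearMap.adjoint_inner_right, ContinuousLinearMap.adjoint_inner_right, h1,
    ← mul_apply_eq_comp, ← mul_apply_eq_comp, (hS (-r)).eq]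

theorem WRep.mul (hU : UGrp U) {k l : ℝ → ℂ} {T S : E →L[ℂ] E} (hk : Integrable k) (hl : Integrable l)
    (hT : WRep U k T) (hS : WRep U l S) : WRep U (fun t => ∫ s, k s * l (t - s)) (T * S) := by
  intro f g
  have h1 : ∀ x y : E, ∀ r, (inner ℂ x (U r y) : ℂ) = inner ℂ (U (-r) x) y := by
    intro x y r; rw [hU.adj, neg_neg]
  have hi := hk.convolution_integrand (ContinuousLinearMap.mul ℝ ℂ) hl
  simp only [ContinuousLinearMap.mul_apply'] at hi
  have hi2 : Integrable (fun p : ℝ × ℝ => k p.2 * l (p.1 - p.2) * inner ℂ g (U p.1 f))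
      (volume.prod volume) := by
    refine hi.mul_bdd (c := ‖g‖ * ‖f‖)
      ((hU.meas f g).comp_measurable measurable_fst).aestronglyMeasurable ?_
    exact ae_of_all _ fun s => hU.bound _ f g
  simp only [mul_apply_eq_comp]
  rw [hT]
  calc ∫ s, k s * inner ℂ g (U s (S f))
      = ∫ s, ∫ t, k s * l (t - s) * inner ℂ g (U t f) := by
        congr 1; ext s
        rw [h1, hS]
        have : ∀ r, l r * inner ℂ (U (-s) g) (U r f) = (fun t => l (t - s) * inner ℂ g (U t f)) (r + s) := by
          intro r
          simp only [add_sub_cancel_right]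
          rw [← h1, ← mul_apply_eq_comp, ← hU.add, add_comm]
        simp_rw [this]
        rw [integral_add_right_eq_self (fun t => l (t - s) * inner ℂ g (U t f)) s,
          ← integral_const_mul]
        simp only [mul_assoc]
    _ = ∫ t, ∫ s, k s * l (t - s) * inner ℂ g (U t f) := by
        rw [integral_integral_swap]
        exact hi2.swap
    _ = _ := by
        congr 1; ext t; rw [integral_mul_const]
end AbsRep


section Kernel

/-- The unnormalised kernel. -/
def gKer (α : ℂ) (s : ℝ) : ℂ :=
  if 0 < s then (s : ℂ) ^ (α - 1) * ((Real.exp (-(s / 2)) : ℝ) : ℂ) else 0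

theorem gKer_eq_indicator (α : ℂ) : gKer α =
    (Set.Ioi (0:ℝ)).indicator (fun s : ℝ => (s : ℂ) ^ (α - 1) * ((Real.exp (-(s / 2)) : ℝ) : ℂ)) := by
  ext s; simp [gKer, Set.indicator]

theorem gKer_norm (α : ℂ) (s : ℝ) : ‖gKer α s‖ =
    (Set.Ioi (0:ℝ)).indicator (fun s : ℝ => s ^ (α.re - 1) * Real.exp (-(s / 2))) s := by
  unfold gKer Set.indicator
  simp only [Set.mem_Ioi]
  split_ifs with h
  · rw [norm_mul, norm_cpow_eq_rpow_re_of_pos h, Complex.norm_of_nonneg (Real.exp_pos _).le]; simp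
  · simp

theorem rker_integrableOn {a : ℝ} (ha : 0 < a) :
    IntegrableOn (fun s : ℝ => s ^ (a - 1) * Real.exp (-(s / 2))) (Set.Ioi 0) := by
  have := integrableOn_rpow_mul_exp_neg_mul_rpow (p := 1) (s := a - 1) (b := 1/2)
    (by linarith) one_pos (by norm_num)
  refine this.congr_fun (fun x _ => ?_) measurableSet_Ioi
  simp only [Real.rpow_one]
  ring_nf

theorem gKer_meas (α : ℂ) : Measurable (gKer α) := by
  unfold gKer
  refine Measurable.ite measurableSet_Ioi ?_ measurable_const
  fun_prop

theorem gKer_integrable {α : ℂ} (hα : 0 < α.re) : Integrable (gKer α) := by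
  rw [← integrable_norm_iff (gKer_meas α).aestronglyMeasurable]
  have : (fun s => ‖gKer α s‖) = (Set.Ioi (0:ℝ)).indicator (fun s : ℝ => s ^ (α.re - 1) * Real.exp (-(s / 2))) :=
    funext fun s => gKer_norm α s
  rw [this, integrable_indicator_iff measurableSet_Ioi]
  exact rker_integrableOn hα

theorem gKer_integral_norm {α : ℂ} (hα : 0 < α.re) :
    ∫ s, ‖gKer α s‖ = 2 ^ α.re * Real.Gamma α.re := by
  simp_rw [gKer_norm]
  rw [integral_indicator measurableSet_Ioi]
  have := Real.integral_rpow_mul_exp_neg_mul_Ioi hα (r := 1/2) (by norm_num)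
  rw [show (1 / (1/2) : ℝ) = 2 by norm_num] at this
  rw [← this]
  congr 1; ext s; ring_nf

theorem gKer_conv {α β : ℂ} (hα : 0 < α.re) (hβ : 0 < β.re) (t : ℝ) (ht : t ≠ 0) :
    Gamma (α + β) * ∫ s, gKer α s * gKer β (t - s) = Gamma α * Gamma β * gKer (α + β) t := by
  rcases lt_or_gt_of_ne ht with h | h
  · have : ∀ s, gKer α s * gKer β (t - s) = 0 := by
      intro s
      unfold gKer
      split_ifs <;> first | linarith | simp
    simp_rw [this]
    simp [gKer, h.le]
  · have h1 : ∀ s, gKer α s * gKer β (t - s) = (Set.Ioo 0 t).indicator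
        (fun s : ℝ => ((Real.exp (-(t / 2)) : ℝ) : ℂ) * ((s : ℂ) ^ (α - 1) * ((t : ℂ) - s) ^ (β - 1))) s := by
      intro s
      simp only [gKer, Set.indicator, Set.mem_Ioo, sub_pos]
      by_cases hs : 0 < s
      · by_cases hs' : s < t
        · simp only [hs, hs', and_self, if_true]
          have : Real.exp (-(t / 2)) = Real.exp (-(s/2)) * Real.exp (-((t - s)/2)) := by
            rw [← Real.exp_add]; ring_nf
          rw [this]; push_cast; ring
        · simp [hs']
      · simp [hs]
    simp_rw [h1]
    rw [integral_indicator measurableSet_Ioo, integral_const_mul, ← integral_Ioc_eq_integral_Ioo,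
      ← intervalIntegral.integral_of_le h.le, betaIntegral_scaled _ _ h,
      Gamma_mul_Gamma_eq_betaIntegral hα hβ]
    simp only [gKer, h, if_true]
    ring

theorem exp_quot_bound {ε : ℝ} (hε : 0 < ε) (L : ℝ) {h : ℂ} (hh : ‖h‖ ≤ ε) (h0 : h ≠ 0) :
    ‖h⁻¹ * (Complex.exp (h * L) - 1)‖ ≤ ε⁻¹ * (Real.exp (2 * ε * L) + Real.exp (-(2 * ε * L))) := by
  have h1 : ‖Complex.exp (h * L) - 1‖ ≤ ‖h‖ * |L| * Real.exp (ε * |L|) := by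
    have := norm_exp_sub_sum_le_norm_mul_exp (h * L) 1
    simp only [Finset.range_one, Finset.sum_singleton, pow_zero, Nat.factorial_zero, Nat.cast_one,
      div_one, pow_one, norm_mul, norm_real, Real.norm_eq_abs] at this
    refine this.trans ?_
    gcongr
  have h2 : ε * |L| ≤ Real.exp (ε * |L|) := by
    have := Real.add_one_le_exp (ε * |L|); linarith
  have h3 : |L| ≤ ε⁻¹ * Real.exp (ε * |L|) := by
    rw [le_inv_mul_iff₀ hε]; exact h2
  have h4 : Real.exp (2 * ε * |L|) ≤ Real.exp (2 * ε * L) + Real.exp (-(2 * ε * L)) := by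
    rcases abs_cases L with ⟨h, _⟩ | ⟨h, _⟩ <;> rw [h]
    · have := Real.exp_pos (-(2 * ε * L)); linarith
    · have := Real.exp_pos ((2 * ε * L))
      rw [mul_neg]; linarith
  have hn : 0 < ‖h‖ := norm_pos_iff.2 h0
  calc ‖h⁻¹ * (Complex.exp (h * L) - 1)‖ = ‖h‖⁻¹ * ‖Complex.exp (h * L) - 1‖ := by
        rw [norm_mul, norm_inv]
    _ ≤ ‖h‖⁻¹ * (‖h‖ * |L| * Real.exp (ε * |L|)) := by gcongr
    _ = |L| * Real.exp (ε * |L|) := by field_simp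
    _ ≤ ε⁻¹ * Real.exp (ε * |L|) * Real.exp (ε * |L|) := by gcongr
    _ = ε⁻¹ * Real.exp (2 * ε * |L|) := by
        rw [mul_assoc, ← Real.exp_add]; ring_nf
    _ ≤ _ := by gcongr

theorem exp_quot_tendsto (L : ℝ) :
    Tendsto (fun h : ℂ => h⁻¹ * (Complex.exp (h * L) - 1)) (nhdsWithin 0 {0}ᶜ) (nhds (L : ℂ)) := by
  have : HasDerivAt (fun h : ℂ => Complex.exp (h * L)) (L : ℂ) 0 := by
    have := ((hasDerivAt_id (0:ℂ)).mul_const (L : ℂ)).cexp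
    simpa using this
  have := hasDerivAt_iff_tendsto_slope.1 this
  refine this.congr fun h => ?_
  simp [slope_def_field, div_eq_inv_mul]

theorem gKer_diff {α : ℂ} (hα : 0 < α.re) :
    Integrable (fun s : ℝ => Real.log s * gKer α s) ∧
    Tendsto (fun h : ℂ => ∫ s, ‖h⁻¹ * (gKer (α + h) s - gKer α s) - Real.log s * gKer α s‖)
      (nhdsWithin 0 {0}ᶜ) (nhds 0) := by
  set ε := α.re / 4 with hε
  have hεp : 0 < ε := by positivity
  have hfac : ∀ (h : ℂ) (s : ℝ), h⁻¹ * (gKer (α + h) s - gKer α s) =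
      h⁻¹ * (Complex.exp (h * Real.log s) - 1) * gKer α s := by
    intro h s
    unfold gKer
    split_ifs with hs
    · have : (s : ℂ) ≠ 0 := by exact_mod_cast hs.ne'
      have h2 : (s : ℂ) ^ (α + h - 1) = (s : ℂ) ^ (α - 1) * Complex.exp (h * Real.log s) := by
        rw [show α + h - 1 = (α - 1) + h by ring, cpow_add _ _ this]
        congr 1
        rw [cpow_def_of_ne_zero this, ← ofReal_log hs.le, mul_comm]
      rw [h2]; ring
    · simp
  let B : ℝ → ℝ := (Set.Ioi (0:ℝ)).indicator fun s =>
    2 * ε⁻¹ * (s ^ ((α.re + 2 * ε) - 1) * Real.exp (-(s / 2)) + s ^ ((α.re - 2 * ε) - 1) * Real.exp (-(s / 2)))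
  have hB : Integrable B := by
    rw [integrable_indicator_iff measurableSet_Ioi]
    refine (Integrable.add ?_ ?_).const_mul _
    · exact rker_integrableOn (by linarith)
    · exact rker_integrableOn (by linarith)
  have hbd : ∀ s, ε⁻¹ * (Real.exp (2 * ε * Real.log s) + Real.exp (-(2 * ε * Real.log s))) * ‖gKer α s‖
      = B s / 2 := by
    intro s
    rw [gKer_norm]
    simp only [B, Set.indicator, Set.mem_Ioi]
    split_ifs with hs
    · have e1 : Real.exp (2 * ε * Real.log s) = s ^ (2 * ε) := by
        rw [Real.rpow_def_of_pos hs, mul_comm]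
      have e2 : Real.exp (-(2 * ε * Real.log s)) = s ^ (-(2 * ε)) := by
        rw [Real.rpow_def_of_pos hs]; ring_nf
      rw [e1, e2, show α.re + 2 * ε - 1 = 2 * ε + (α.re - 1) by ring,
        show α.re - 2 * ε - 1 = -(2 * ε) + (α.re - 1) by ring, Real.rpow_add hs, Real.rpow_add hs]
      ring
    · simp
  have hb1 : ∀ h : ℂ, ‖h‖ ≤ ε → h ≠ 0 → ∀ s,
      ‖h⁻¹ * (gKer (α + h) s - gKer α s)‖ ≤ B s / 2 := by
    intro h hh h0 s
    rw [hfac, norm_mul, ← hbd]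
    gcongr
    exact exp_quot_bound hεp _ hh h0
  have hev : ∀ᶠ h : ℂ in nhdsWithin 0 {0}ᶜ, ‖h‖ ≤ ε ∧ h ≠ 0 := by
    have h1 : ∀ᶠ h : ℂ in nhdsWithin 0 {0}ᶜ, ‖h‖ ≤ ε := by
      filter_upwards [nhdsWithin_le_nhds (Metric.closedBall_mem_nhds (0:ℂ) hεp)] with h hh
      simpa using hh
    filter_upwards [h1, self_mem_nhdsWithin] with h h1 h2 using ⟨h1, h2⟩
  have hlim : ∀ s, Tendsto (fun h : ℂ => h⁻¹ * (gKer (α + h) s - gKer α s))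
      (nhdsWithin 0 {0}ᶜ) (nhds (Real.log s * gKer α s)) := by
    intro s
    simp_rw [hfac]
    exact (exp_quot_tendsto (Real.log s)).mul_const _
  have hb2 : ∀ s, ‖Real.log s * gKer α s‖ ≤ B s / 2 := by
    intro s
    refine le_of_tendsto (hlim s).norm ?_
    filter_upwards [hev] with h hh using hb1 h hh.1 hh.2 s
  refine ⟨(hB.div_const 2).mono' ?_ (ae_of_all _ hb2), ?_⟩
  · have := gKer_meas α
    exact Measurable.aestronglyMeasurable (by fun_prop)
  have := tendsto_integral_filter_of_dominated_convergence (μ := (volume : Measure ℝ))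
    (l := nhdsWithin (0:ℂ) {0}ᶜ)
    (F := fun h s => ‖h⁻¹ * (gKer (α + h) s - gKer α s) - Real.log s * gKer α s‖)
    (f := fun _ => (0:ℝ)) B ?_ ?_ hB ?_
  · simpa using this
  · refine Eventually.of_forall fun h => ?_
    have := gKer_meas α
    have := gKer_meas (α + h)
    exact Measurable.aestronglyMeasurable (by fun_prop)
  · filter_upwards [hev] with h hh
    refine ae_of_all _ fun s => ?_
    rw [norm_norm]
    calc _ ≤ _ := norm_sub_le _ _
      _ ≤ B s / 2 + B s / 2 := add_le_add (hb1 h hh.1 hh.2 s) (hb2 s)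
      _ = B s := by ring
  · refine ae_of_all _ fun s => ?_
    have := ((hlim s).sub_const (Real.log s * gKer α s)).norm
    simpa using this

end Kernel


theorem exists_lim_of_dist_le {ι F : Type*} [NormedAddCommGroup F] [CompleteSpace F] {l : Filter ι}
    [l.NeBot] {q : ι → F} {ρ : ι → ℝ} (hρ : Tendsto ρ l (nhds 0)) {P : ι → Prop} (hP : ∀ᶠ i in l, P i)
    (h : ∀ i j, P i → P j → ‖q i - q j‖ ≤ ρ i + ρ j) : ∃ x, Tendsto q l (nhds x) := by
  rw [← cauchy_map_iff_exists_tendsto, Metric.cauchy_iff]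
  refine ⟨inferInstance, fun ε hε => ?_⟩
  refine ⟨q '' {i | P i ∧ ρ i < ε / 2}, ?_, ?_⟩
  · refine image_mem_map ?_
    filter_upwards [hP, hρ.eventually (gt_mem_nhds (half_pos hε))] with i h1 h2 using ⟨h1, h2⟩
  · rintro _ ⟨i, hi, rfl⟩ _ ⟨j, hj, rfl⟩
    rw [dist_eq_norm]
    have := h i j hi.1 hj.1
    have h1 := hi.2
    have h2 := hj.2
    linarith

section AbsHol
variable {E : Type*} [NormedAddCommGroup E] [InnerProductSpace ℂ E] [CompleteSpace E]
variable {U : ℝ → E →L[ℂ] E}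

theorem WRep.differentiableAt (hU : UGrp U) {G : ℂ → E →L[ℂ] E}
    (hG : ∀ α : ℂ, 0 < α.re → WRep U (gKer α) (G α)) {α : ℂ} (hα : 0 < α.re) :
    DifferentiableAt ℂ G α := by
  obtain ⟨hD, hlim⟩ := gKer_diff hα
  have hev : ∀ᶠ h : ℂ in nhdsWithin 0 {0}ᶜ, 0 < (α + h).re := by
    have : ContinuousAt (fun h : ℂ => (α + h).re) 0 := by fun_prop
    refine nhdsWithin_le_nhds (this.eventually (lt_mem_nhds ?_))
    simpa using hα
  obtain ⟨G', hG'⟩ := exists_lim_of_dist_le (q := fun h : ℂ => h⁻¹ • (G (α + h) - G α)) hlim hev (by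
    intro i j hi hj
    have ki : ∀ i : ℂ, 0 < (α + i).re → Integrable (fun s => i⁻¹ * (gKer (α + i) s - gKer α s)) :=
      fun i hi => ((gKer_integrable hi).sub (gKer_integrable hα)).const_mul _
    have wi : ∀ i : ℂ, 0 < (α + i).re →
        WRep U (fun s => i⁻¹ * (gKer (α + i) s - gKer α s)) (i⁻¹ • (G (α + i) - G α)) :=
      fun i hi => ((hG _ hi).sub hU (gKer_integrable hi) (gKer_integrable hα) (hG _ hα)).smul _
    have h1 := ((wi i hi).sub hU (ki i hi) (ki j hj) (wi j hj)).norm_le hU ((ki i hi).sub (ki j hj))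
    refine h1.trans ?_
    have di : ∀ i : ℂ, 0 < (α + i).re →
        Integrable (fun s => ‖i⁻¹ * (gKer (α + i) s - gKer α s) - Real.log s * gKer α s‖) :=
      fun i hi => ((ki i hi).sub hD).norm
    rw [← integral_add (di i hi) (di j hj)]
    refine integral_mono ((ki i hi).sub (ki j hj)).norm
      ((di i hi).add (di j hj)) fun s => ?_
    simp only [Pi.sub_apply, Pi.add_apply]
    have := norm_sub_le (i⁻¹ * (gKer (α + i) s - gKer α s) - Real.log s * gKer α s)
      (j⁻¹ * (gKer (α + j) s - gKer α s) - Real.log s * gKer α s)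
    rwa [sub_sub_sub_cancel_right] at this)
  refine HasDerivAt.differentiableAt (f' := G') ?_
  rw [hasDerivAt_iff_tendsto_slope_zero]
  exact hG'

theorem WRep.inj [SecondCountableTopology E] (hU : UGrp U) {T : E →L[ℂ] E}
    (hT : WRep U (gKer 1) T) {f : E} (hf : T f = 0) : f = 0 := by
  have h1 : ∀ x y : E, ∀ r, (inner ℂ x (U r y) : ℂ) = inner ℂ (U (-r) x) y := by
    intro x y r; rw [hU.adj, neg_neg]
  have hk : ∀ s : ℝ, gKer 1 s = (Set.Ioi 0).indicator (fun s : ℝ => ((Real.exp (-(s/2)) : ℝ) : ℂ)) s := by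
    intro s; simp [gKer, Set.indicator]
  have hae : ∀ g : E, ∀ᵐ s : ℝ, (inner ℂ g (U s f) : ℂ) = 0 := by
    intro g
    set φ : ℝ → ℂ := fun s => ((Real.exp (-(s/2)) : ℝ) : ℂ) * inner ℂ g (U s f) with hφ
    have e0 : ∀ r s : ℝ, (Set.Ioi r).indicator φ (s + r)
        = ((Real.exp (-(r/2)) : ℝ) : ℂ) * (gKer 1 s * inner ℂ (U (-r) g) (U s f)) := by
      intro r s
      rw [hk, ← h1, ← mul_apply_eq_comp, ← hU.add]
      simp only [Set.indicator, Set.mem_Ioi, hφ, lt_add_iff_pos_left]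
      split_ifs
      · rw [← mul_assoc, ← ofReal_mul, ← Real.exp_add, add_comm r s]
        congr 4; ring
      · simp
    have hintg : ∀ r, Integrable ((Set.Ioi r).indicator φ) := by
      intro r
      have hi : Integrable (fun s => (Set.Ioi r).indicator φ (s + r)) := by
        simp_rw [e0]
        exact (hU.integrable (gKer_integrable (by simp)) _ _).const_mul _
      simpa using hi.comp_sub_right r
    have hzero : ∀ r, ∫ s in Set.Ioi r, φ s = 0 := by
      intro r
      rw [← integral_indicator measurableSet_Ioi, ← integral_add_right_eq_self _ r]
      simp_rw [e0]
      rw [integral_const_mul, ← hT, hf]; simp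
    have hio : ∀ r, IntegrableOn φ (Set.Ioi r) := fun r =>
      (integrable_indicator_iff measurableSet_Ioi).1 (hintg r)
    have hloc : LocallyIntegrable φ := by
      intro x
      exact ⟨Set.Ioi (x - 1), Ioi_mem_nhds (by linarith), hio _⟩
    filter_upwards [LocallyIntegrable.ae_hasDerivAt_integral hloc] with x hx
    have h2 := hx 0
    have h3 : (fun x => ∫ t in (0:ℝ)..x, φ t) = fun _ => 0 := by
      ext x
      rw [intervalIntegral.integral_Ioi_sub_Ioi' (hio 0) (hio x) |>.symm, hzero, hzero, sub_zero]
    rw [h3] at h2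
    have h4 : φ x = 0 := h2.unique (hasDerivAt_const x (0:ℂ))
    simpa [hφ] using h4
  have hall : ∀ᵐ s : ℝ, ∀ n : ℕ, (inner ℂ (TopologicalSpace.denseSeq E n) (U s f) : ℂ) = 0 :=
    ae_all_iff.2 fun n => hae _
  obtain ⟨s, hs⟩ := hall.exists
  have h5 : U s f = 0 := by
    have hc : ∀ x : E, (inner ℂ x (U s f) : ℂ) = 0 := by
      have : (fun x : E => (inner ℂ x (U s f) : ℂ)) = fun _ => 0 :=
        (TopologicalSpace.denseRange_denseSeq E).equalizer (by fun_prop) continuous_const (funext hs)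
      exact fun x => congrFun this x
    exact inner_self_eq_zero.1 (hc (U s f))
  rw [← norm_eq_zero, ← hU.norm s, h5, norm_zero]

end AbsHol


section AbsSG
variable {E : Type*} [NormedAddCommGroup E] [InnerProductSpace ℂ E] [CompleteSpace E]

/-- A semigroup of commuting normal operators, norm continuous for positive times. -/
structure NSG (T : ℝ → E →L[ℂ] E) : Prop where
  zero : T 0 = 1
  add : ∀ s t, 0 < s → 0 < t → T s * T t = T (s + t)
  bound : ∀ t, 0 < t → ‖T t‖ ≤ Real.exp (Real.log 2 * t)
  cont : ContinuousOn T (Set.Ioi 0)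
  scont : ∀ f, ContinuousOn (fun t => T t f) (Set.Ici 0)
  comm : ∀ s t, 0 < s → 0 < t → Commute (T s) (star (T t))

/-- Generic form of the generator predicate. -/
def IsGen (T : ℝ → E →L[ℂ] E) (A : E →ₗ.[ℂ] E) : Prop :=
  ∀ f : E,
    (f ∈ A.domain ↔ ∃ g : E,
      Filter.Tendsto (fun t : ℝ => (t : ℂ)⁻¹ • (T t f - f))
        (nhdsWithin 0 (Set.Ioi 0)) (nhds g)) ∧
    ∀ hf : f ∈ A.domain,
      Filter.Tendsto (fun t : ℝ => (t : ℂ)⁻¹ • (T t f - f))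
        (nhdsWithin 0 (Set.Ioi 0)) (nhds (A ⟨f, hf⟩))

variable {T : ℝ → E →L[ℂ] E}

/-- The resolvent as a Laplace transform. -/
def resInt (T : ℝ → E →L[ℂ] E) (z : ℂ) : E →L[ℂ] E :=
  ∫ t in Set.Ioi (0:ℝ), Complex.exp (-z * t) • T t

theorem NSG.integrableOn (hT : NSG T) {z : ℂ} (hz : Real.log 2 < z.re) :
    IntegrableOn (fun t : ℝ => Complex.exp (-z * t) • T t) (Set.Ioi (0:ℝ)) := by
  have h1 : IntegrableOn (fun t : ℝ => Real.exp ((Real.log 2 - z.re) * t)) (Set.Ioi 0) :=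
    integrableOn_exp_mul_Ioi (by linarith) 0
  refine Integrable.mono' h1 ?_ ?_
  · refine ContinuousOn.aestronglyMeasurable ?_ measurableSet_Ioi
    have he : ContinuousOn (fun t : ℝ => Complex.exp (-z * t)) (Set.Ioi 0) := by fun_prop
    exact he.smul hT.cont
  · refine (ae_restrict_iff' measurableSet_Ioi).2 (ae_of_all _ fun t ht => ?_)
    rw [norm_smul, Complex.norm_exp]
    have : (-z * t).re = -z.re * t := by simp
    rw [this, show (Real.log 2 - z.re) * t = -z.re * t + Real.log 2 * t by ring, Real.exp_add]
    gcongr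
    exact hT.bound t ht

theorem NSG.comm_res (hT : NSG T) {z : ℂ} (hz : Real.log 2 < z.re) {S : E →L[ℂ] E}
    (hS : ∀ t, 0 < t → Commute S (T t)) : Commute S (resInt T z) := by
  unfold Commute SemiconjBy resInt
  rw [← integral_const_mul_of_integrable (hT.integrableOn hz),
    ← integral_mul_const_of_integrable (hT.integrableOn hz)]
  refine setIntegral_congr_fun measurableSet_Ioi fun t ht => ?_
  simp only [mul_smul_comm, smul_mul_assoc]
  rw [(hS t ht).eq]

theorem NSG.commTT (hT : NSG T) {s t : ℝ} (hs : 0 < s) (ht : 0 < t) : Commute (T s) (T t) := by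
  unfold Commute SemiconjBy
  rw [hT.add s t hs ht, hT.add t s ht hs, add_comm]

theorem NSG.res_normal (hT : NSG T) {z : ℂ} (hz : Real.log 2 < z.re) :
    Commute (star (resInt T z)) (resInt T z) := by
  refine hT.comm_res hz fun t ht => ?_
  have h1 : Commute (star (T t)) (resInt T z) :=
    hT.comm_res hz fun s hs => (hT.comm s t hs ht).symm
  have h2 := h1.star_star
  rw [star_star] at h2
  exact h2.symm

/-- Difference quotient. -/
def dq (T : ℝ → E →L[ℂ] E) (t : ℝ) : E →L[ℂ] E := (t : ℂ)⁻¹ • (T t - 1)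

theorem dq_apply (t : ℝ) (f : E) : dq T t f = (t : ℂ)⁻¹ • (T t f - f) := by
  simp [dq]

theorem NSG.comm_dq (hT : NSG T) {s t : ℝ} (hs : 0 < s) (ht : 0 < t) :
    Commute (dq T s) (star (dq T t)) := by
  unfold dq
  rw [star_smul, star_sub, star_one]
  refine Commute.smul_left (Commute.smul_right ?_ _) _
  exact ((hT.comm s t hs ht).sub_left (Commute.one_left _)).sub_right
    (Commute.one_right _)

theorem norm_star_apply {N : E →L[ℂ] E} (h : Commute N (star N)) (f : E) : ‖star N f‖ = ‖N f‖ := by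
  have : IsStarNormal N := ⟨h.symm⟩
  exact (ContinuousLinearMap.isStarNormal_iff_norm_eq_adjoint.1 this f).symm

theorem NSG.norm_dq_sub (hT : NSG T) {s t : ℝ} (hs : 0 < s) (ht : 0 < t) (f : E) :
    ‖star (dq T s) f - star (dq T t) f‖ = ‖dq T s f - dq T t f‖ := by
  have h : Commute (dq T s - dq T t) (star (dq T s - dq T t)) := by
    rw [star_sub]
    exact ((hT.comm_dq hs hs).sub_left (hT.comm_dq ht hs)).sub_right
      ((hT.comm_dq hs ht).sub_left (hT.comm_dq ht ht))
  have := norm_star_apply h f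
  rw [star_sub] at this
  simpa using this

theorem NSG.res_tendsto (hT : NSG T) {z : ℂ} (hz : Real.log 2 < z.re) (f : E) :
    Tendsto (fun t : ℝ => (t : ℂ)⁻¹ • (T t (resInt T z f) - resInt T z f))
      (nhdsWithin 0 (Set.Ioi 0)) (nhds (z • resInt T z f - f)) := by
  set φ : ℝ → E := fun t => Complex.exp (-z * t) • T t f with hφ
  have hI := hT.integrableOn hz
  have hφI : IntegrableOn φ (Set.Ioi 0) := by
    have := (ContinuousLinearMap.apply ℂ E f).integrable_comp hI
    exact this
  have hR : resInt T z f = ∫ t in Set.Ioi (0:ℝ), φ t := by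
    unfold resInt
    rw [ContinuousLinearMap.integral_apply hI]; rfl
  have hcont : ContinuousOn φ (Set.Ici 0) := ContinuousOn.smul (by fun_prop) (hT.scont f)
  have hTR : ∀ h : ℝ, 0 < h → T h (resInt T z f) =
      Complex.exp (z * h) • (resInt T z f - ∫ t in (0:ℝ)..h, φ t) := by
    intro h hh
    have hsub : resInt T z f - ∫ t in (0:ℝ)..h, φ t = ∫ t in Set.Ioi h, φ t := by
      rw [hR, ← intervalIntegral.integral_Ioi_sub_Ioi' hφI (hφI.mono_set (Set.Ioi_subset_Ioi hh.le))]
      abel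
    rw [hsub, hR, ← ContinuousLinearMap.integral_comp_comm _ hφI, ← integral_smul,
      ← integral_indicator measurableSet_Ioi, ← integral_indicator measurableSet_Ioi,
      ← integral_add_right_eq_self ((Set.Ioi h).indicator fun a => Complex.exp (z * h) • φ a) h]
    congr 1; ext t
    simp only [Set.indicator, Set.mem_Ioi, lt_add_iff_pos_left, hφ]
    split_ifs with ht
    · rw [map_smul, smul_smul, ← Complex.exp_add, ← mul_apply_eq_comp, hT.add h t hh ht, add_comm h t]
      congr 2; push_cast; ring
    · rfl
  have hder : Tendsto (fun h : ℝ => (h : ℂ)⁻¹ • ∫ t in (0:ℝ)..h, φ t)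
      (nhdsWithin 0 (Set.Ioi 0)) (nhds f) := by
    have hd : HasDerivWithinAt (fun u => ∫ x in (0:ℝ)..u, φ x) (φ 0) (Set.Ici 0) 0 := by
      refine intervalIntegral.integral_hasDerivWithinAt_right (t := Set.Ioi 0) (by simp) ?_ ?_
      · exact ⟨Set.Ioi 0, self_mem_nhdsWithin, hφI.aestronglyMeasurable⟩
      · exact (hcont 0 Set.self_mem_Ici).mono Set.Ioi_subset_Ici_self
    have h0 : φ 0 = f := by simp [hφ, hT.zero]
    rw [h0] at hd
    have hd2 := (hasDerivWithinAt_iff_tendsto_slope.1 hd)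
    rw [show Set.Ici (0:ℝ) \ {0} = Set.Ioi 0 from Set.Ici_sdiff_left] at hd2
    refine hd2.congr fun h => ?_
    simp only [slope, sub_zero, vsub_eq_sub, intervalIntegral.integral_same]
    rw [← ofReal_inv, Complex.coe_smul]
  have hexp : Tendsto (fun h : ℝ => (h : ℂ)⁻¹ * (Complex.exp (z * h) - 1))
      (nhdsWithin 0 (Set.Ioi 0)) (nhds z) := by
    have hd : HasDerivAt (fun h : ℝ => Complex.exp (z * h)) z 0 := by
      have := ((hasDerivAt_id (0:ℝ)).ofReal_comp.const_mul z).cexp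
      simpa using this
    have hd2 := hasDerivWithinAt_iff_tendsto_slope.1 (hd.hasDerivWithinAt (s := Set.Ici 0))
    rw [show Set.Ici (0:ℝ) \ {0} = Set.Ioi 0 from Set.Ici_sdiff_left] at hd2
    refine hd2.congr fun h => ?_
    simp [slope]
  have hexp2 : Tendsto (fun h : ℝ => Complex.exp (z * h)) (nhdsWithin 0 (Set.Ioi 0)) (nhds 1) := by
    have : Continuous (fun h : ℝ => Complex.exp (z * h)) := by fun_prop
    have h2 := this.tendsto 0
    simp only [ofReal_zero, mul_zero, Complex.exp_zero] at h2
    exact h2.mono_left nhdsWithin_le_nhds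
  have hfin := (hexp.smul_const (resInt T z f)).sub (hexp2.smul hder)
  rw [one_smul] at hfin
  refine hfin.congr' ?_
  filter_upwards [self_mem_nhdsWithin] with h hh
  rw [hTR h hh]
  module

theorem NSG.isRes (hT : NSG T) {A : E →ₗ.[ℂ] E} (hA : IsGen T A) {z : ℂ} (hz : Real.log 2 < z.re) :
    (∀ f : E, ∃ hf : resInt T z f ∈ A.domain, z • (resInt T z f) - A ⟨resInt T z f, hf⟩ = f) ∧
    (∀ f : E, ∀ hf : f ∈ A.domain, resInt T z (z • f - A ⟨f, hf⟩) = f) := by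
  have h1 : ∀ f : E, ∃ hf : resInt T z f ∈ A.domain, A ⟨resInt T z f, hf⟩ = z • (resInt T z f) - f := by
    intro f
    have h := hT.res_tendsto hz f
    have hf := (hA (resInt T z f)).1.2 ⟨_, h⟩
    exact ⟨hf, tendsto_nhds_unique ((hA _).2 hf) h⟩
  refine ⟨fun f => ?_, fun f hf => ?_⟩
  · obtain ⟨hf, e⟩ := h1 f
    exact ⟨hf, by rw [e]; abel⟩
  · have h2 := ((resInt T z).continuous.tendsto _).comp ((hA f).2 hf)
    have h3 : Tendsto (fun t : ℝ => (t : ℂ)⁻¹ • (T t (resInt T z f) - resInt T z f))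
      (nhdsWithin 0 (Set.Ioi 0)) (nhds (resInt T z (A ⟨f, hf⟩))) := by
      refine h2.congr' ?_
      filter_upwards [self_mem_nhdsWithin] with t ht
      have hc : Commute (T t) (resInt T z) := hT.comm_res hz fun s hs => hT.commTT ht hs
      simp only [Function.comp, map_smul, map_sub]
      rw [← mul_apply_eq_comp, ← hc.eq]; rfl
    have h4 := tendsto_nhds_unique h3 (hT.res_tendsto hz f)
    rw [map_sub, map_smul, h4]; abel

theorem NSG.dense (hT : NSG T) {A : E →ₗ.[ℂ] E} (hA : IsGen T A) : Dense (A.domain : Set E) := by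
  obtain ⟨z, hz⟩ : ∃ z : ℂ, Real.log 2 < z.re := ⟨((Real.log 2 + 1 : ℝ) : ℂ), by
    rw [ofReal_re]; linarith⟩
  obtain ⟨r1, r2⟩ := hT.isRes hA hz
  rw [Submodule.dense_iff_topologicalClosure_eq_top, Submodule.topologicalClosure_eq_top_iff,
    Submodule.eq_bot_iff]
  intro f hf
  rw [Submodule.mem_orthogonal] at hf
  have h1 : star (resInt T z) f = 0 := by
    refine ext_inner_left ℂ fun g => ?_
    rw [ContinuousLinearMap.star_eq_adjoint, ContinuousLinearMap.adjoint_inner_right, inner_zero_right]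
    exact hf _ (r1 g).1
  have h2 : resInt T z f = 0 := by
    rw [← norm_eq_zero, ← norm_star_apply (hT.res_normal hz).symm, h1, norm_zero]
  obtain ⟨hd, e⟩ := r1 f
  have h3 : (⟨resInt T z f, hd⟩ : A.domain) = 0 := Subtype.ext h2
  rw [← e, h3, h2, LinearPMap.map_zero]; simp

theorem NSG.normal (hT : NSG T) {A : E →ₗ.[ℂ] E} (hA : IsGen T A) :
    A.adjoint.domain = A.domain ∧
      ∀ (f : E) (hf : f ∈ A.domain) (hf' : f ∈ A.adjoint.domain),
        ‖A ⟨f, hf⟩‖ = ‖A.adjoint ⟨f, hf'⟩‖ := by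
  have hden := hT.dense hA
  have hpos : ∀ᶠ t : ℝ in nhdsWithin 0 (Set.Ioi 0), 0 < t := self_mem_nhdsWithin
  have hgen : ∀ (f : E) (hf : f ∈ A.domain),
      Tendsto (fun t => dq T t f) (nhdsWithin 0 (Set.Ioi 0)) (nhds (A ⟨f, hf⟩)) := by
    intro f hf
    simp_rw [dq_apply]
    exact (hA f).2 hf
  have key : ∀ (f : E) (hf : f ∈ A.domain), ∃ g : E, ‖g‖ = ‖A ⟨f, hf⟩‖ ∧
      ∀ x : A.domain, inner ℂ g (x : E) = (inner ℂ f (A x) : ℂ) := by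
    intro f hf
    have hl := hgen f hf
    have hρ : Tendsto (fun t => ‖dq T t f - A ⟨f, hf⟩‖) (nhdsWithin 0 (Set.Ioi 0)) (nhds 0) := by
      simpa using (hl.sub_const (A ⟨f, hf⟩)).norm
    obtain ⟨g, hg⟩ := exists_lim_of_dist_le (q := fun t => star (dq T t) f) hρ hpos (by
      intro s t hs ht
      rw [hT.norm_dq_sub hs ht]
      have := norm_sub_le (dq T s f - A ⟨f, hf⟩) (dq T t f - A ⟨f, hf⟩)
      rwa [sub_sub_sub_cancel_right] at this)
    refine ⟨g, ?_, fun x => ?_⟩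
    · refine tendsto_nhds_unique hg.norm (hl.norm.congr' ?_)
      filter_upwards [hpos] with t ht
      exact (norm_star_apply (hT.comm_dq ht ht) f).symm
    · have e1 : Tendsto (fun t => (inner ℂ (star (dq T t) f) (x : E) : ℂ)) (nhdsWithin 0 (Set.Ioi 0))
          (nhds (inner ℂ g (x : E))) := hg.inner tendsto_const_nhds
      have e2 : Tendsto (fun t => (inner ℂ f (dq T t (x : E)) : ℂ)) (nhdsWithin 0 (Set.Ioi 0))
          (nhds (inner ℂ f (A x))) := tendsto_const_nhds.inner (hgen x x.2)
      refine tendsto_nhds_unique e1 (e2.congr fun t => ?_)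
      rw [ContinuousLinearMap.star_eq_adjoint, ContinuousLinearMap.adjoint_inner_left]
  refine ⟨le_antisymm ?_ ?_, ?_⟩
  · intro f hf
    obtain ⟨z, hz⟩ : ∃ z : ℂ, Real.log 2 < z.re := ⟨((Real.log 2 + 1 : ℝ) : ℂ), by
      rw [ofReal_re]; linarith⟩
    obtain ⟨r1, r2⟩ := hT.isRes hA hz
    set R := resInt T z with hR
    set g := (starRingEnd ℂ z) • f - A.adjoint ⟨f, hf⟩ with hg
    have hfg : star R g = f := by
      refine ext_inner_right ℂ fun h => ?_
      rw [ContinuousLinearMap.star_eq_adjoint, ContinuousLinearMap.adjoint_inner_left]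
      obtain ⟨hd, e⟩ := r1 h
      have e3 := LinearPMap.adjoint_isFormalAdjoint hden ⟨f, hf⟩ ⟨R h, hd⟩
      simp only at e3
      rw [hg, inner_sub_left, inner_smul_left, e3, ← inner_smul_left, inner_smul_left]
      simp only [RingHomCompTriple.comp_apply, RingHom.id_apply]
      rw [← inner_smul_right, ← inner_sub_right, e]
    have hl := hgen (R g) (r1 g).1
    have hρ : Tendsto (fun t => ‖dq T t (R g) - A ⟨R g, (r1 g).1⟩‖) (nhdsWithin 0 (Set.Ioi 0)) (nhds 0) := by
      simpa using (hl.sub_const (A ⟨R g, (r1 g).1⟩)).norm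
    have hcR : ∀ t, 0 < t → Commute (dq T t) R := by
      intro t ht
      unfold dq
      refine Commute.smul_left (Commute.sub_left ?_ (Commute.one_left _)) _
      exact hT.comm_res hz fun s hs => hT.commTT ht hs
    have hcR' : ∀ t, 0 < t → Commute (dq T t) (star R) := by
      intro t ht
      have h1 : Commute (star (T t)) R := hT.comm_res hz fun s hs => (hT.comm s t hs ht).symm
      have h2 := h1.star_star
      rw [star_star] at h2
      unfold dq
      exact Commute.smul_left (Commute.sub_left h2 (Commute.one_left _)) _
    obtain ⟨y, hy⟩ := exists_lim_of_dist_le (q := fun t => dq T t f) hρ hpos (by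
      intro s t hs ht
      have hn : ‖dq T s f - dq T t f‖ = ‖dq T s (R g) - dq T t (R g)‖ := by
        have hc : Commute (dq T s - dq T t) R := (hcR s hs).sub_left (hcR t ht)
        have hc' : Commute (dq T s - dq T t) (star R) := (hcR' s hs).sub_left (hcR' t ht)
        rw [← sub_apply, ← sub_apply, ← mul_apply_eq_comp, hc.eq, ← hfg, ← mul_apply_eq_comp, hc'.eq,
          mul_apply_eq_comp, mul_apply_eq_comp, norm_star_apply (hT.res_normal hz).symm]
      rw [hn]
      have := norm_sub_le (dq T s (R g) - A ⟨R g, (r1 g).1⟩) (dq T t (R g) - A ⟨R g, (r1 g).1⟩)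
      rwa [sub_sub_sub_cancel_right] at this)
    simp_rw [dq_apply] at hy
    exact (hA f).1.2 ⟨y, hy⟩
  · intro f hf
    obtain ⟨g, -, hg⟩ := key f hf
    exact LinearPMap.mem_adjoint_domain_of_exists f ⟨g, hg⟩
  · intro f hf hf'
    obtain ⟨g, hn, hg⟩ := key f hf
    rw [LinearPMap.adjoint_apply_eq hden ⟨f, hf'⟩ hg, hn]

end AbsSG


section Concrete

theorem qmp_mul {c : ℝ} (hc : c ≠ 0) :
    Measure.QuasiMeasurePreserving (fun x : ℝ => c * x) volume volume := by
  refine ⟨by fun_prop, ?_⟩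
  rw [Real.map_volume_mul_left hc]
  exact Measure.smul_absolutelyContinuous

/-- Normalised dilation of functions. -/
def dilFun (s : ℝ) (f : ℝ → ℂ) : ℝ → ℂ :=
  fun x => ((Real.exp (-(s / 2)) : ℝ) : ℂ) * f (Real.exp (-s) * x)

theorem dilFun_eLpNorm (s : ℝ) {f : ℝ → ℂ} (hf : AEStronglyMeasurable f volume) :
    eLpNorm (dilFun s f) 2 volume = eLpNorm f 2 volume := by
  have hc : Real.exp (-s) ≠ 0 := (Real.exp_pos _).ne'
  have h1 : dilFun s f = ((Real.exp (-(s / 2)) : ℝ) : ℂ) • (f ∘ fun x => Real.exp (-s) * x) := by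
    ext x; simp [dilFun]
  have hm : Measure.map (fun x => Real.exp (-s) * x) volume = ENNReal.ofReal (Real.exp s) • (volume : Measure ℝ) := by
    rw [Real.map_volume_mul_left hc, Real.exp_neg, inv_inv, abs_of_pos (Real.exp_pos _)]
  rw [h1, eLpNorm_const_smul, ← eLpNorm_map_measure _ (by fun_prop), hm,
    eLpNorm_smul_measure_of_ne_top (by simp), smul_eq_mul, ← mul_assoc]
  · have : ‖((Real.exp (-(s / 2)) : ℝ) : ℂ)‖ₑ * ENNReal.ofReal (Real.exp s) ^ (1 / (2:ENNReal).toReal) = 1 := by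
      rw [ENNReal.ofReal_rpow_of_pos (Real.exp_pos _), ← ofReal_norm_eq_enorm,
        Complex.norm_of_nonneg (Real.exp_pos _).le, ← ENNReal.ofReal_mul (Real.exp_pos _).le, ← Real.exp_mul, ← Real.exp_add]
      simp
      ring
    have h2 : (1 / (2:ENNReal)).toReal = 1 / (2:ENNReal).toReal := by simp
    first
    | rw [this, one_mul]
    | rw [h2, this, one_mul]
  · rw [hm]
    exact hf.mono_ac Measure.smul_absolutelyContinuous

theorem dilFun_ae {f g : ℝ → ℂ} (s : ℝ) (h : f =ᵐ[volume] g) : dilFun s f =ᵐ[volume] dilFun s g := by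
  filter_upwards [(qmp_mul (Real.exp_pos (-s)).ne').ae h] with x hx
  simp only [dilFun, hx]

theorem dilFun_memLp (s : ℝ) {f : ℝ → ℂ} (hf : MemLp f 2 volume) : MemLp (dilFun s f) 2 volume := by
  refine ⟨?_, ?_⟩
  · unfold dilFun
    exact (hf.1.comp_quasiMeasurePreserving (qmp_mul (Real.exp_pos (-s)).ne')).const_mul _
  · rw [dilFun_eLpNorm s hf.1]; exact hf.2

/-- Normalised dilation group on `L²`. -/
def dil (s : ℝ) : L2 →L[ℂ] L2 :=
  LinearMap.mkContinuous
    { toFun := fun f => (dilFun_memLp s (Lp.memLp f)).toLp _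
      map_add' := fun f g => by
        rw [← MemLp.toLp_add]
        refine MemLp.toLp_congr _ _ ?_
        refine (dilFun_ae s (Lp.coeFn_add f g)).trans (ae_of_all _ fun x => ?_)
        simp [dilFun, mul_add]
      map_smul' := fun c f => by
        rw [RingHom.id_apply, ← MemLp.toLp_const_smul]
        refine MemLp.toLp_congr _ _ ?_
        refine (dilFun_ae s (Lp.coeFn_smul c f)).trans (ae_of_all _ fun x => ?_)
        simp [dilFun]; ring } 1 (fun f => by
        simp only [LinearMap.coe_mk, AddHom.coe_mk, Lp.norm_toLp, one_mul]
        rw [dilFun_eLpNorm s (Lp.aestronglyMeasurable f), Lp.norm_def])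

theorem dil_coe (s : ℝ) (f : L2) : dil s f =ᵐ[volume] dilFun s f :=
  MemLp.coeFn_toLp (dilFun_memLp s (Lp.memLp f))

theorem dil_norm (s : ℝ) (f : L2) : ‖dil s f‖ = ‖f‖ := by
  rw [Lp.norm_def, Lp.norm_def, eLpNorm_congr_ae (dil_coe s f), dilFun_eLpNorm s (Lp.aestronglyMeasurable f)]

theorem dil_inner (s : ℝ) (f g : L2) :
    (inner ℂ g (dil s f) : ℂ) = ∫ x, (starRingEnd ℂ) (g x) * dilFun s f x := by
  rw [L2.inner_def]
  refine integral_congr_ae ?_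
  filter_upwards [dil_coe s f] with x hx
  rw [hx, RCLike.inner_apply, mul_comm]

theorem dil_ugrp : UGrp dil := by
  have hadd : ∀ s t, dil (s + t) = dil s * dil t := by
    intro s t
    ext1 f
    refine Lp.ext ?_
    rw [mul_apply_eq_comp]
    refine (dil_coe _ _).trans (EventuallyEq.symm ?_)
    refine (dil_coe _ _).trans ((dilFun_ae s (dil_coe t f)).trans (ae_of_all _ fun x => ?_))
    simp only [dilFun]
    rw [← mul_assoc, ← mul_assoc, ← ofReal_mul, ← Real.exp_add, ← Real.exp_add]
    congr 2
    · congr 2; ring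
    · congr 2; ring
  have hzero : dil 0 = 1 := by
    ext1 f
    refine Lp.ext ?_
    refine (dil_coe _ _).trans (ae_of_all _ fun x => ?_)
    simp [dilFun]
  refine ⟨hzero, hadd, dil_norm, ?_, ?_⟩
  · intro s f g
    let V : L2 →ₗᵢ[ℂ] L2 := ⟨(dil s).toLinearMap, dil_norm s⟩
    have h1 : dil s (dil (-s) g) = g := by
      rw [← mul_apply_eq_comp, ← hadd, add_neg_cancel, hzero]; rfl
    have h2 : (inner ℂ (V f) (V (dil (-s) g)) : ℂ) = inner ℂ f (dil (-s) g) := V.inner_map_map _ _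
    rw [← h2]
    change _ = (inner ℂ (dil s f) (dil s (dil (-s) g)) : ℂ)
    rw [h1]
  · intro f g
    simp_rw [dil_inner]
    have hf := Lp.stronglyMeasurable f
    have hg := Lp.stronglyMeasurable g
    refine StronglyMeasurable.integral_prod_right' (f := fun p : ℝ × ℝ => (starRingEnd ℂ) (g p.2) * dilFun p.1 f p.2) ?_
    refine Measurable.stronglyMeasurable ?_
    have := hf.measurable
    have := hg.measurable
    unfold dilFun
    fun_prop

theorem holder_subst (α : ℂ) (f : ℝ → ℂ) (x : ℝ) :
    ∫ u, holderKernel α u * f (u * x) = ∫ s, ((Gamma α)⁻¹ * gKer α s) * dilFun s f x := by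
  have himg : (fun s : ℝ => Real.exp (-s)) '' Set.Ioi 0 = Set.Ioo 0 1 := by
    ext u
    constructor
    · rintro ⟨s, hs, rfl⟩
      have : 0 < s := hs
      exact ⟨Real.exp_pos _, by simpa using this⟩
    · rintro ⟨h0, h1⟩
      exact ⟨-Real.log u, by simpa using Real.log_neg h0 h1, by simp [Real.exp_log h0]⟩
  have h1 : ∀ u, holderKernel α u * f (u * x) = (Set.Ioo (0:ℝ) 1).indicator
      (fun u => (Gamma α)⁻¹ * ((Real.log u⁻¹ : ℝ) : ℂ) ^ (α - 1) * f (u * x)) u := by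
    intro u
    simp only [holderKernel, Set.indicator]
    split_ifs <;> simp
  simp_rw [h1]
  rw [integral_indicator measurableSet_Ioo, ← himg,
    integral_image_eq_integral_abs_deriv_smul (f' := fun s => -Real.exp (-s)) measurableSet_Ioi, gKer_eq_indicator,
    ← integral_indicator measurableSet_Ioi]
  · congr 1; ext s
    simp only [Set.indicator, dilFun]
    split_ifs
    · rw [abs_neg, abs_of_pos (Real.exp_pos _), ← Real.exp_neg, neg_neg, Real.log_exp, real_smul]
      have : Real.exp (-s) = Real.exp (-(s/2)) * Real.exp (-(s/2)) := by rw [← Real.exp_add]; ring_nf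
      rw [show ((Real.exp (-s) : ℝ) : ℂ) = ((Real.exp (-(s/2)) : ℝ) : ℂ) * ((Real.exp (-(s/2)) : ℝ) : ℂ) by
        rw [← ofReal_mul, ← this]]
      ring
    · simp
  · intro s _
    have := ((hasDerivAt_id s).neg.exp).hasDerivWithinAt (s := Set.Ioi 0)
    simpa using this
  · intro a _ b _ h
    simpa using h

theorem holder_wrep {α : ℂ} (hα : 0 < α.re) {T : L2 →L[ℂ] L2} (hT : IsHausdorffOp (holderKernel α) T) :
    WRep dil (fun s => (Gamma α)⁻¹ * gKer α s) T := by
  intro f g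
  set k : ℝ → ℂ := fun s => (Gamma α)⁻¹ * gKer α s with hk
  have hki : Integrable k := (gKer_integrable hα).const_mul _
  have hkm : Measurable k := (gKer_meas α).const_mul _
  have hf := (Lp.stronglyMeasurable f).measurable
  have hg := (Lp.stronglyMeasurable g).measurable
  have hmeas : Measurable (fun p : ℝ × ℝ => (starRingEnd ℂ) (g p.1) * (k p.2 * dilFun p.2 f p.1)) := by
    unfold dilFun
    fun_prop
  have hsl : ∀ s, Integrable (fun x => (starRingEnd ℂ) (g x) * dilFun s f x) := by
    intro s
    have := L2.integrable_inner (𝕜 := ℂ) g (dil s f)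
    refine this.congr ?_
    filter_upwards [dil_coe s f] with x hx
    rw [hx, RCLike.inner_apply, mul_comm]
  have hnb : ∀ s, ∫ x, ‖(starRingEnd ℂ) (g x) * dilFun s f x‖ ≤ ‖g‖ * ‖f‖ := by
    intro s
    have hgm := Lp.memLp g
    have hfm := dilFun_memLp s (Lp.memLp f)
    have := integral_mul_norm_le_Lp_mul_Lq (μ := (volume : Measure ℝ)) (p := 2) (q := 2) (f := g) (g := dilFun s f)
      (by constructor <;> norm_num) (by simpa using hgm) (by simpa using hfm)
    simp only [norm_mul, RCLike.norm_conj]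
    refine this.trans (le_of_eq ?_)
    have e : ∀ h : ℝ → ℂ, MemLp h 2 volume → (∫ x, ‖h x‖ ^ (2:ℝ)) ^ (1/2:ℝ) = (eLpNorm h 2 volume).toReal := by
      intro h hh
      rw [MemLp.eLpNorm_eq_integral_rpow_norm (by simp) (by simp) hh, ENNReal.toReal_ofReal (by positivity)]
      simp
    rw [e _ hgm, e _ hfm, dilFun_eLpNorm s (Lp.aestronglyMeasurable f), Lp.norm_def, Lp.norm_def]
  have hintg : Integrable (fun p : ℝ × ℝ => (starRingEnd ℂ) (g p.1) * (k p.2 * dilFun p.2 f p.1))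
      (volume.prod volume) := by
    rw [integrable_prod_iff' hmeas.aestronglyMeasurable]
    refine ⟨ae_of_all _ fun s => ?_, ?_⟩
    · refine ((hsl s).const_mul (k s)).congr (ae_of_all _ fun x => ?_)
      simp only; ring
    · refine (hki.norm.mul_const (‖g‖ * ‖f‖)).mono' ?_ (ae_of_all _ fun s => ?_)
      · exact (hmeas.norm.stronglyMeasurable.integral_prod_left' (μ := volume)).aestronglyMeasurable
      · rw [Real.norm_of_nonneg (integral_nonneg fun _ => norm_nonneg _)]
        have : ∀ x, ‖(starRingEnd ℂ) (g x) * (k s * dilFun s f x)‖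
            = ‖k s‖ * ‖(starRingEnd ℂ) (g x) * dilFun s f x‖ := by
          intro x; rw [← norm_mul]; congr 1; ring
        simp_rw [this]
        rw [integral_const_mul]
        exact mul_le_mul_of_nonneg_left (hnb s) (norm_nonneg _)
  rw [L2.inner_def]
  calc ∫ x, inner ℂ (g x) (T f x)
      = ∫ x, ∫ s, (starRingEnd ℂ) (g x) * (k s * dilFun s f x) := by
        refine integral_congr_ae ?_
        filter_upwards [hT f] with x hx
        rw [hx, holder_subst, RCLike.inner_apply, mul_comm, integral_const_mul]
    _ = ∫ s, ∫ x, (starRingEnd ℂ) (g x) * (k s * dilFun s f x) := integral_integral_swap hintg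
    _ = _ := by
        congr 1; ext s
        rw [dil_inner, ← integral_const_mul]
        congr 1; ext x; ring

theorem holder_pos {t : ℝ} (ht : 0 < t) {T : L2 →L[ℂ] L2} (hT : IsHausdorffOp (holderKernel t) T) (f : L2)
    (hf : ∀ᵐ x : ℝ ∂MeasureTheory.volume, 0 ≤ (f x).re ∧ (f x).im = 0) :
    ∀ᵐ x : ℝ ∂MeasureTheory.volume, 0 ≤ (T f x).re ∧ (T f x).im = 0 := by
  have h0 : ∀ᵐ x : ℝ, x ≠ 0 := by simp [ae_iff, measure_singleton]
  filter_upwards [hT f, h0] with x hx hx0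
  have h1 : ∀ᵐ u : ℝ, 0 ≤ (f (u * x)).re ∧ (f (u * x)).im = 0 := by
    have := (qmp_mul hx0).ae hf
    filter_upwards [this] with u hu
    rwa [mul_comm] at hu
  let r : ℝ → ℝ := fun u => (if u ∈ Set.Ioo (0:ℝ) 1 then (Real.Gamma t)⁻¹ * (Real.log u⁻¹) ^ (t - 1) else 0)
    * (f (u * x)).re
  have hr : ∀ᵐ u : ℝ, holderKernel t u * f (u * x) = ((r u : ℝ) : ℂ) ∧ 0 ≤ r u := by
    filter_upwards [h1] with u hu
    have e1 : f (u * x) = (((f (u * x)).re : ℝ) : ℂ) := Complex.ext (by simp) (by simp [hu.2])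
    simp only [r, holderKernel]
    split_ifs with h
    · have hl : 0 ≤ Real.log u⁻¹ := Real.log_nonneg ((one_le_inv₀ h.1).2 h.2.le)
      refine ⟨?_, ?_⟩
      · rw [e1, Complex.Gamma_ofReal]
        push_cast
        rw [Complex.ofReal_cpow hl]
        push_cast
        simp
      · have := Real.Gamma_pos_of_pos ht
        have := hu.1
        positivity
    · simp
  have hi : ∫ u, holderKernel t u * f (u * x) = ((∫ u, r u : ℝ) : ℂ) := by
    rw [← integral_complex_ofReal]
    exact integral_congr_ae (hr.mono fun u hu => hu.1)
  rw [hx, hi]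
  refine ⟨?_, ofReal_im _⟩
  rw [ofReal_re]
  exact integral_nonneg_of_ae (hr.mono fun u hu => hu.2)

end Concrete

/-- With `H 0 = I`, the family `(H_α)_{Re α > 0}` of Hölder
operators on `L²(ℝ)` is a semigroup (`H_α H_β = H_{α+β}`) which is holomorphic in
the open right half-plane; its generator `A = log C` is a densely defined normal
operator (same domain as its adjoint, with `‖A f‖ = ‖A† f‖`) whose spectrum lies in
the half-plane `{Re z ≤ log 2}` (every `z` with `Re z > log 2` has a resolvent),
and the restriction of the semigroup to `{α ≥ 0}` is a positivity-preserving
C₀-semigroup. -/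
theorem stmt9
    (H : ℂ → (L2 →L[ℂ] L2)) (hH0 : H 0 = 1)
    (hHdef : ∀ α : ℂ, 0 < α.re → IsHausdorffOp (holderKernel α) (H α))
    (A : L2 →ₗ.[ℂ] L2) (hA : IsGeneratorOf (fun t : ℝ => H (t : ℂ)) A) :
    (∀ α β : ℂ, 0 < α.re → 0 < β.re → H α * H β = H (α + β)) ∧
    DifferentiableOn ℂ H {α : ℂ | 0 < α.re} ∧
    Dense (A.domain : Set L2) ∧
    (A.adjoint.domain = A.domain ∧
      ∀ (f : L2) (hf : f ∈ A.domain) (hf' : f ∈ A.adjoint.domain),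
        ‖A ⟨f, hf⟩‖ = ‖A.adjoint ⟨f, hf'⟩‖) ∧
    (∀ z : ℂ, Real.log 2 < z.re → ∃ R : L2 →L[ℂ] L2, IsResolventOf A z R) ∧
    (∀ f : L2, ContinuousOn (fun t : ℝ => H (t : ℂ) f) (Set.Ici 0)) ∧
    (∀ t : ℝ, 0 ≤ t → ∀ f : L2,
      (∀ᵐ x : ℝ ∂MeasureTheory.volume, 0 ≤ (f x).re ∧ (f x).im = 0) →
      (∀ᵐ x : ℝ ∂MeasureTheory.volume,
        0 ≤ (H (t : ℂ) f x).re ∧ (H (t : ℂ) f x).im = 0)) := by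
  have hΓ : ∀ α : ℂ, 0 < α.re → Gamma α ≠ 0 := fun α hα => Gamma_ne_zero_of_re_pos hα
  have hW : ∀ α : ℂ, 0 < α.re → WRep dil (fun s => (Gamma α)⁻¹ * gKer α s) (H α) :=
    fun α hα => holder_wrep hα (hHdef α hα)
  have hki : ∀ α : ℂ, 0 < α.re → Integrable (fun s => (Gamma α)⁻¹ * gKer α s) :=
    fun α hα => (gKer_integrable hα).const_mul _
  have hsg : ∀ α β : ℂ, 0 < α.re → 0 < β.re → H α * H β = H (α + β) := by
    intro α β hα hβ
    have hαβ : 0 < (α + β).re := by rw [add_re]; linarith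
    refine WRep.unique (((hW α hα).mul dil_ugrp (hki α hα) (hki β hβ) (hW β hβ)).congr ?_) (hW _ hαβ)
    have h0 : ∀ᵐ x : ℝ, x ≠ 0 := by simp [ae_iff, measure_singleton]
    filter_upwards [h0] with t ht
    have h1 := gKer_conv hα hβ t ht
    have h2 : ∀ s, (Gamma α)⁻¹ * gKer α s * ((Gamma β)⁻¹ * gKer β (t - s))
        = ((Gamma α)⁻¹ * (Gamma β)⁻¹) * (gKer α s * gKer β (t - s)) := fun s => by ring
    simp_rw [h2]
    rw [integral_const_mul]
    have := hΓ α hα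
    have := hΓ β hβ
    have := hΓ _ hαβ
    field_simp
    linear_combination h1
  have hdiff : ∀ α : ℂ, 0 < α.re → DifferentiableAt ℂ H α := by
    intro α hα
    have hG : ∀ α : ℂ, 0 < α.re → WRep dil (gKer α) (Gamma α • H α) := by
      intro α hα
      refine ((hW α hα).smul (Gamma α)).congr (ae_of_all _ fun s => ?_)
      show Gamma α * ((Gamma α)⁻¹ * gKer α s) = gKer α s
      rw [← mul_assoc, mul_inv_cancel₀ (hΓ α hα), one_mul]
    have h1 := WRep.differentiableAt dil_ugrp hG hα
    have h2 : DifferentiableAt ℂ Gamma α := by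
      refine differentiableAt_Gamma α fun m hm => ?_
      rw [hm] at hα
      simp only [neg_re, natCast_re] at hα
      have : (0:ℝ) ≤ m := Nat.cast_nonneg m
      linarith
    have h3 : DifferentiableAt ℂ (fun α => (Gamma α)⁻¹ • (Gamma α • H α)) α :=
      (h2.inv (hΓ α hα)).smul h1
    refine h3.congr_of_eventuallyEq ?_
    filter_upwards [(isOpen_lt continuous_const continuous_re).mem_nhds hα] with β hβ
    rw [smul_smul, inv_mul_cancel₀ (hΓ β hβ), one_smul]
  have hbound : ∀ t : ℝ, 0 < t → ‖H (t : ℂ)‖ ≤ Real.exp (Real.log 2 * t) := by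
    intro t ht
    have ht' : 0 < (t : ℂ).re := by simpa using ht
    refine ((hW t ht').norm_le dil_ugrp (hki t ht')).trans (le_of_eq ?_)
    simp_rw [norm_mul]
    have hg := Real.Gamma_pos_of_pos ht
    rw [integral_const_mul, gKer_integral_norm ht', norm_inv, Complex.Gamma_ofReal,
      Complex.norm_of_nonneg hg.le, ofReal_re, Real.rpow_def_of_pos two_pos]
    field_simp
  have hcomm : ∀ α β : ℂ, 0 < α.re → 0 < β.re → Commute (H α) (star (H β)) := by
    intro α β hα hβ
    have h1 : ∀ r, Commute (dil r) (star (H β)) := fun r =>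
      dil_ugrp.comm_adj (fun r => (hW β hβ).commU dil_ugrp r) r
    exact ((hW α hα).comm h1).symm
  have hcontT : ContinuousOn (fun t : ℝ => H (t : ℂ)) (Set.Ioi 0) := by
    intro t ht
    have : 0 < (t : ℂ).re := by simpa using ht
    exact (ContinuousAt.comp (f := fun t : ℝ => (t : ℂ)) (hdiff t this).continuousAt
      continuous_ofReal.continuousAt).continuousWithinAt
  have hinj : ∀ f : L2, H 1 f = 0 → f = 0 := by
    intro f hf
    have hrep : WRep dil (gKer 1) (H 1) := by
      refine (hW 1 (by simp)).congr (ae_of_all _ fun s => ?_)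
      simp
    haveI : Fact ((2 : ENNReal) ≠ ⊤) := ⟨by simp⟩
    haveI : SecondCountableTopology L2 := MeasureTheory.Lp.SecondCountableTopology
    exact WRep.inj dil_ugrp hrep hf
  have hdense : DenseRange (H 1) := by
    have : Dense ((LinearMap.range (H 1).toLinearMap : Submodule ℂ L2) : Set L2) := by
      rw [Submodule.dense_iff_topologicalClosure_eq_top, Submodule.topologicalClosure_eq_top_iff,
        Submodule.eq_bot_iff]
      intro f hf
      rw [Submodule.mem_orthogonal] at hf
      refine hinj f ?_
      rw [← norm_eq_zero, ← norm_star_apply (hcomm 1 1 (by simp) (by simp)), norm_eq_zero]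
      refine ext_inner_left ℂ fun g => ?_
      rw [ContinuousLinearMap.star_eq_adjoint, ContinuousLinearMap.adjoint_inner_right, inner_zero_right]
      exact hf _ ⟨g, rfl⟩
    exact this
  have hzero : ∀ f : L2, Tendsto (fun t : ℝ => H (t : ℂ) f) (nhdsWithin 0 (Set.Ioi 0)) (nhds f) := by
    intro f
    rw [Metric.tendsto_nhds]
    intro ε hε
    obtain ⟨g, hg⟩ := hdense.exists_dist_lt f (show 0 < ε / 4 by positivity)
    rw [dist_eq_norm] at hg
    have hc : Tendsto (fun t : ℝ => H (t + 1 : ℂ) g) (nhdsWithin 0 (Set.Ioi 0)) (nhds (H 1 g)) := by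
      have h1 : ContinuousAt (fun t : ℝ => H (t + 1 : ℂ)) 0 := by
        have hd := (hdiff 1 (by simp)).continuousAt
        refine ContinuousAt.comp (f := fun t : ℝ => (t + 1 : ℂ)) (g := H) ?_ (by fun_prop)
        simpa using hd
      have h2 : Tendsto (fun t : ℝ => H (t + 1 : ℂ)) (nhds 0) (nhds (H 1)) := by
        simpa using h1.tendsto
      exact ((ContinuousLinearMap.apply ℂ L2 g).continuous.tendsto (H 1)).comp
        (h2.mono_left nhdsWithin_le_nhds)
    have hlt1 : ∀ᶠ t : ℝ in nhdsWithin 0 (Set.Ioi 0), t < 1 :=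
      nhdsWithin_le_nhds (gt_mem_nhds one_pos)
    filter_upwards [Metric.tendsto_nhds.1 hc (ε / 4) (by positivity), self_mem_nhdsWithin, hlt1]
      with t h1 h2 h3
    have ht : 0 < t := h2
    have ht' : 0 < (t : ℂ).re := by simpa using ht
    rw [dist_eq_norm] at h1 ⊢
    rw [← hsg t 1 ht' (by simp), mul_apply_eq_comp] at h1
    have hb : ‖H (t : ℂ)‖ ≤ 2 := by
      refine (hbound t ht).trans ?_
      calc Real.exp (Real.log 2 * t) ≤ Real.exp (Real.log 2) := by
            refine Real.exp_le_exp.2 ?_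
            have := Real.log_pos (one_lt_two (α := ℝ))
            nlinarith
        _ = 2 := Real.exp_log two_pos
    have e : H (t : ℂ) f - f = H (t : ℂ) (f - H 1 g) + ((H (t : ℂ) (H 1 g) - H 1 g) - (f - H 1 g)) := by
      rw [map_sub]; abel
    rw [e]
    have n1 : ‖H (t : ℂ) (f - H 1 g)‖ ≤ 2 * ‖f - H 1 g‖ :=
      ((H (t : ℂ)).le_opNorm _).trans (mul_le_mul_of_nonneg_right hb (norm_nonneg _))
    have n2 := norm_add_le (H (t : ℂ) (f - H 1 g)) ((H (t : ℂ) (H 1 g) - H 1 g) - (f - H 1 g))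
    have n3 := norm_sub_le (H (t : ℂ) (H 1 g) - H 1 g) (f - H 1 g)
    linarith
  have hscont : ∀ f : L2, ContinuousOn (fun t : ℝ => H (t : ℂ) f) (Set.Ici 0) := by
    intro f t ht
    rcases (show (0:ℝ) ≤ t from ht).eq_or_lt with h | h
    · subst h
      rw [← continuousWithinAt_Ioi_iff_Ici]
      have := hzero f
      unfold ContinuousWithinAt
      have e0 : (fun t : ℝ => H (t : ℂ) f) 0 = f := by simp [hH0]
      rw [e0]
      exact this
    · have h1 : ContinuousAt (fun t : ℝ => H (t : ℂ)) t :=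
        (hcontT t h).continuousAt (Ioi_mem_nhds h)
      have h2 := (ContinuousLinearMap.apply ℂ L2 f).continuous.continuousAt.comp h1
      exact ContinuousAt.continuousWithinAt h2
  have hN : NSG (fun t : ℝ => H (t : ℂ)) := by
    refine ⟨by simp [hH0], ?_, hbound, hcontT, hscont, ?_⟩
    · intro s t hs ht
      have := hsg s t (by simpa using hs) (by simpa using ht)
      simpa using this
    · intro s t hs ht
      exact hcomm s t (by simpa using hs) (by simpa using ht)
  have hA' : IsGen (fun t : ℝ => H (t : ℂ)) A := hA
  refine ⟨hsg, fun α hα => (hdiff α hα).differentiableWithinAt, hN.dense hA', hN.normal hA',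
    fun z hz => ⟨resInt (fun t : ℝ => H (t : ℂ)) z, hN.isRes hA' hz⟩, hscont, ?_⟩
  intro t ht f hf
  rcases ht.eq_or_lt with h | h
  · subst h
    rw [ofReal_zero, hH0]
    exact hf
  · exact holder_pos h (hHdef t (by simpa using h)) f hf
end
end

section
/- For every f ∈ L²(ℝ), lim_{t→+∞} 2^{−t}·‖H_t f‖ = 0, where H_t is the Hölder operator of order t > 0 on L²(ℝ); i.e., the semigroup T(t) = 2^{−t}H_t is uniformly stable. -/
open MeasureTheory Complex Filter

noncomputable section

open scoped ENNReal

lemma cs_lintegral {α : Type*} [MeasurableSpace α] {μ : Measure α} {c p q : α → ℝ≥0∞}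
    (hp : AEMeasurable p μ) (hq : AEMeasurable q μ) (h : ∀ᵐ u ∂μ, c u ^ 2 ≤ p u * q u) :
    (∫⁻ u, c u ∂μ) ^ 2 ≤ (∫⁻ u, p u ∂μ) * (∫⁻ u, q u ∂μ) := by
  have h1 : ∫⁻ u, c u ∂μ ≤ ∫⁻ u, p u ^ (1/2:ℝ) * q u ^ (1/2:ℝ) ∂μ := by
    apply lintegral_mono_ae
    filter_upwards [h] with u hu
    rw [← ENNReal.mul_rpow_of_nonneg _ _ (by norm_num)]
    have := ENNReal.rpow_le_rpow hu (show (0:ℝ) ≤ 1/2 by norm_num)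
    rwa [← ENNReal.rpow_natCast, ← ENNReal.rpow_mul, show ((2:ℕ):ℝ) * (1/2) = 1 by norm_num,
      ENNReal.rpow_one] at this
  have h2 := h1.trans (ENNReal.lintegral_mul_norm_pow_le hp hq (p := 1/2) (q := 1/2)
    (by norm_num) (by norm_num) (by norm_num))
  rw [← ENNReal.mul_rpow_of_nonneg _ _ (by norm_num)] at h2
  have := ENNReal.rpow_le_rpow h2 (show (0:ℝ) ≤ (2:ℕ) by norm_num)
  rwa [← ENNReal.rpow_mul, show (1/2) * ((2:ℕ):ℝ) = 1 by norm_num,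
      ENNReal.rpow_one, ENNReal.rpow_natCast] at this

lemma scale_lintegral {G : ℝ → ℝ≥0∞} (hG : Measurable G) {a : ℝ} (ha : a ≠ 0) :
    ∫⁻ x, G (a * x) = ENNReal.ofReal |a⁻¹| * ∫⁻ x, G x := by
  rw [← lintegral_map (μ := volume) (g := fun x => a * x) hG (measurable_const_mul a),
    Real.map_volume_mul_left ha, lintegral_smul_measure, smul_eq_mul]

lemma gamma_lintegral {a b : ℝ} (ha : 0 < a) (hb : 0 < b) :
    ∫⁻ u in Set.Ioo (0:ℝ) 1, ENNReal.ofReal ((Real.log u⁻¹) ^ (a - 1) * u ^ (b - 1))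
      = ENNReal.ofReal ((1 / b) ^ a * Real.Gamma a) := by
  have him : (fun v : ℝ => Real.exp (-v)) '' Set.Ioi 0 = Set.Ioo 0 1 := by
    ext u
    simp only [Set.mem_image, Set.mem_Ioi, Set.mem_Ioo]
    constructor
    · rintro ⟨v, hv, rfl⟩
      exact ⟨Real.exp_pos _, by simpa using hv⟩
    · rintro ⟨h0, h1⟩
      exact ⟨-Real.log u, by simpa using Real.log_neg h0 h1, by simp [Real.exp_log h0]⟩
  rw [← him, lintegral_image_eq_lintegral_abs_deriv_mul (f' := fun v => -Real.exp (-v))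
    measurableSet_Ioi]
  · have hint := Real.integral_rpow_mul_exp_neg_mul_Ioi ha hb
    have hne : (1 / b) ^ a * Real.Gamma a ≠ 0 :=
      (mul_pos (by positivity) (Real.Gamma_pos_of_pos ha)).ne'
    rw [← hint, ofReal_integral_eq_lintegral_ofReal]
    · refine setLIntegral_congr_fun measurableSet_Ioi fun v hv => ?_
      have hv : 0 < v := hv
      try dsimp only
      rw [← ENNReal.ofReal_mul (abs_nonneg _), abs_neg, abs_of_pos (Real.exp_pos _),
        ← Real.exp_neg, neg_neg, Real.log_exp, ← Real.exp_mul]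
      congr 1
      rw [mul_left_comm, ← Real.exp_add]
      congr 2
      ring
    · exact Integrable.of_integral_ne_zero (by rw [hint]; exact hne)
    · refine (ae_restrict_iff' measurableSet_Ioi).2 (Eventually.of_forall fun v hv => ?_)
      have hv : 0 < v := hv
      dsimp
      positivity
  · intro v hv
    have := ((hasDerivAt_id v).neg.exp).hasDerivWithinAt (s := Set.Ioi 0)
    simpa using this
  · intro x _ y _ h
    simpa using h

/-- absolute value of the kernel -/
def kk (t : ℝ) (u : ℝ) : ℝ≥0∞ := ENNReal.ofReal ((Real.Gamma t)⁻¹ * (Real.log u⁻¹) ^ (t - 1))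

lemma measurable_kk (t : ℝ) : Measurable (kk t) := by
  unfold kk
  fun_prop

lemma kernel_bound {t : ℝ} (ht : 0 < t) {T : L2 →L[ℂ] L2}
    (hT : IsHausdorffOp (holderKernel (t : ℂ)) T) (f : L2) :
    ∀ᵐ x : ℝ, ‖T f x‖ₑ ≤ ∫⁻ u in Set.Ioo (0:ℝ) 1, kk t u * ‖f (u * x)‖ₑ := by
  filter_upwards [hT f] with x hx
  rw [hx]
  refine (enorm_integral_le_lintegral_enorm _).trans ?_
  rw [← lintegral_indicator measurableSet_Ioo]
  refine lintegral_mono fun u => ?_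
  by_cases hu : u ∈ Set.Ioo (0:ℝ) 1
  · have hl : 0 < Real.log u⁻¹ := Real.log_pos ((one_lt_inv₀ hu.1).2 hu.2)
    rw [Set.indicator_of_mem hu, enorm_mul]
    refine mul_le_mul_left (le_of_eq ?_) _
    rw [holderKernel, if_pos hu, kk, Complex.Gamma_ofReal,
      show (t : ℂ) - 1 = ((t - 1 : ℝ) : ℂ) by push_cast; rfl,
      ← Complex.ofReal_cpow hl.le, ← Complex.ofReal_inv, ← Complex.ofReal_mul,
      ← ofReal_norm, Complex.norm_real, Real.norm_of_nonneg]
    have := Real.Gamma_pos_of_pos ht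
    positivity
  · simp [holderKernel, hu]

lemma enorm_sq (f : L2) : ‖f‖ₑ ^ 2 = ∫⁻ x, ‖f x‖ₑ ^ 2 := by
  have h := eLpNorm_nnreal_pow_eq_lintegral (μ := (volume : Measure ℝ)) (f := f) (p := 2) (by simp)
  have e : ((2 : NNReal) : ℝ) = ((2 : ℕ) : ℝ) := by norm_num
  simp only [e, ENNReal.rpow_natCast] at h
  rw [← h, Lp.enorm_def]
  rfl

lemma enorm_bound {t : ℝ} (ht : 0 < t) {T : L2 →L[ℂ] L2}
    (hT : IsHausdorffOp (holderKernel (t : ℂ)) T) (f : L2) :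
    ‖T f‖ₑ ^ 2 ≤ ∫⁻ x, (∫⁻ u in Set.Ioo (0:ℝ) 1, kk t u * ‖f (u * x)‖ₑ) ^ 2 := by
  rw [enorm_sq]
  refine lintegral_mono_ae ?_
  filter_upwards [kernel_bound ht hT f] with x hx
  gcongr

lemma meas_f (f : L2) : Measurable (fun x => ‖f x‖ₑ) :=
  (Lp.stronglyMeasurable f).measurable.enorm

lemma bound_one {t : ℝ} (ht : 0 < t) {T : L2 →L[ℂ] L2}
    (hT : IsHausdorffOp (holderKernel (t : ℂ)) T) (f : L2) :
    ‖T f‖ ≤ 2 ^ t * ‖f‖ := by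
  have hG := Real.Gamma_pos_of_pos ht
  set P : ℝ≥0∞ := ∫⁻ u in Set.Ioo (0:ℝ) 1, kk t u * ENNReal.ofReal (u ^ (-(1/2) : ℝ)) with hP
  have hPv : P = ENNReal.ofReal (2 ^ t) := by
    have h := gamma_lintegral ht (show (0:ℝ) < 1/2 by norm_num)
    have h2 : P = ENNReal.ofReal (Real.Gamma t)⁻¹ * ∫⁻ u in Set.Ioo (0:ℝ) 1,
        ENNReal.ofReal ((Real.log u⁻¹) ^ (t - 1) * u ^ ((1/2:ℝ) - 1)) := by
      rw [← lintegral_const_mul _ (by fun_prop), hP]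
      refine setLIntegral_congr_fun measurableSet_Ioo fun u hu => ?_
      have hl : 0 < Real.log u⁻¹ := Real.log_pos ((one_lt_inv₀ hu.1).2 hu.2)
      try dsimp only
      rw [kk, ← ENNReal.ofReal_mul (by positivity), ← ENNReal.ofReal_mul (by positivity)]
      norm_num
      ring_nf
    rw [h2, h, ← ENNReal.ofReal_mul (by positivity)]
    congr 1
    field_simp
  have hmk := measurable_kk t
  have hmf := meas_f f
  have key : ‖T f‖ₑ ^ 2 ≤ (P * ‖f‖ₑ) ^ 2 := by
    refine (enorm_bound ht hT f).trans ?_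
    calc _ ≤ ∫⁻ x, P * ∫⁻ u in Set.Ioo (0:ℝ) 1,
            kk t u * ENNReal.ofReal (u ^ (1/2:ℝ)) * ‖f (u * x)‖ₑ ^ 2 := by
          refine lintegral_mono fun x => cs_lintegral (by fun_prop)
            (Measurable.aemeasurable ?_) ?_
          · have : Measurable fun u => ‖f (u * x)‖ₑ := hmf.comp (measurable_mul_const x)
            fun_prop
          · refine (ae_restrict_iff' measurableSet_Ioo).2 (Eventually.of_forall fun u hu => ?_)
            have hu0 := hu.1
            have : ENNReal.ofReal (u ^ (-(1/2) : ℝ)) * ENNReal.ofReal (u ^ (1/2:ℝ)) = 1 := by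
              rw [← ENNReal.ofReal_mul (by positivity), ← Real.rpow_add hu0]
              norm_num
            calc _ = (kk t u * kk t u * ‖f (u * x)‖ₑ ^ 2) * 1 := by ring
              _ ≤ _ := by rw [← this]; apply le_of_eq; ring
      _ = P * ∫⁻ u in Set.Ioo (0:ℝ) 1, ∫⁻ x,
            kk t u * ENNReal.ofReal (u ^ (1/2:ℝ)) * ‖f (u * x)‖ₑ ^ 2 := by
          have hm : Measurable (Function.uncurry fun x u : ℝ =>
              kk t u * ENNReal.ofReal (u ^ (1/2:ℝ)) * ‖f (u * x)‖ₑ ^ 2) := by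
            have : Measurable fun z : ℝ × ℝ => ‖f (z.2 * z.1)‖ₑ :=
              hmf.comp (measurable_snd.mul measurable_fst)
            unfold Function.uncurry
            fun_prop
          rw [lintegral_const_mul _ (Measurable.lintegral_prod_right hm),
            lintegral_lintegral_swap hm.aemeasurable]
      _ = P * ∫⁻ u in Set.Ioo (0:ℝ) 1,
            kk t u * ENNReal.ofReal (u ^ (-(1/2):ℝ)) * ‖f‖ₑ ^ 2 := by
          congr 1
          refine setLIntegral_congr_fun measurableSet_Ioo fun u hu => ?_
          have hu0 := hu.1
          have hm : Measurable fun x => ‖f x‖ₑ ^ 2 := by fun_prop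
          try dsimp only
          rw [lintegral_const_mul (f := fun x => ‖f (u * x)‖ₑ ^ 2) _ (hm.comp (measurable_const_mul u)),
            scale_lintegral hm hu0.ne', ← enorm_sq, ← mul_assoc, mul_assoc (kk t u),
            ← ENNReal.ofReal_mul (by positivity), abs_of_pos (by positivity),
            ← Real.rpow_neg_one u, ← Real.rpow_add hu0]
          norm_num
      _ = _ := by
          rw [lintegral_mul_const _ (by fun_prop), ← hP]
          ring
  have k2 : ‖T f‖ₑ ≤ P * ‖f‖ₑ := (ENNReal.pow_le_pow_left_iff (by norm_num)).1 key
  rw [hPv, ← ofReal_norm, ← ofReal_norm,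
    ← ENNReal.ofReal_mul (by positivity)] at k2
  exact (ENNReal.ofReal_le_ofReal_iff (by positivity)).1 k2

lemma bound_two {t : ℝ} (ht : 1 < t) {T : L2 →L[ℂ] L2}
    (hT : IsHausdorffOp (holderKernel (t : ℂ)) T) (f : L2) {A : ℝ} (hA0 : 0 ≤ A)
    (hA : ∫⁻ y, ‖f y‖ₑ * ENNReal.ofReal (|y| ^ (-(1/2):ℝ)) = ENNReal.ofReal A) :
    ‖T f‖ ^ 2 ≤ A ^ 2 * (Real.Gamma (2 * t - 1) / Real.Gamma t ^ 2) := by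
  have ht0 : 0 < t := by linarith
  have hG := Real.Gamma_pos_of_pos ht0
  have hG2 := Real.Gamma_pos_of_pos (show 0 < 2 * t - 1 by linarith)
  have hmk := measurable_kk t
  have hmf := meas_f f
  set Q : ℝ≥0∞ := ∫⁻ u in Set.Ioo (0:ℝ) 1, kk t u ^ 2 with hQ
  have hQv : Q = ENNReal.ofReal (Real.Gamma (2 * t - 1) / Real.Gamma t ^ 2) := by
    have h := gamma_lintegral (show 0 < 2 * t - 1 by linarith) (show (0:ℝ) < 1 by norm_num)
    have h2 : Q = ENNReal.ofReal ((Real.Gamma t)⁻¹ ^ 2) * ∫⁻ u in Set.Ioo (0:ℝ) 1,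
        ENNReal.ofReal ((Real.log u⁻¹) ^ (2 * t - 1 - 1) * u ^ ((1:ℝ) - 1)) := by
      rw [← lintegral_const_mul _ (by fun_prop), hQ]
      refine setLIntegral_congr_fun measurableSet_Ioo fun u hu => ?_
      have hl : 0 < Real.log u⁻¹ := Real.log_pos ((one_lt_inv₀ hu.1).2 hu.2)
      try dsimp only
      rw [kk, ← ENNReal.ofReal_mul (by positivity), ← ENNReal.ofReal_pow (by positivity),
        mul_pow, ← Real.rpow_mul_natCast hl.le]
      congr 2
      rw [sub_self, Real.rpow_zero, mul_one]
      congr 1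
      push_cast
      ring
    rw [h2, h, ← ENNReal.ofReal_mul (by positivity)]
    congr 1
    simp
    field_simp
  set G : ℝ → ℝ≥0∞ := fun y => ‖f y‖ₑ * ENNReal.ofReal (|y| ^ (-(1/2):ℝ)) with hGdef
  have hmG : Measurable G := by fun_prop
  have hFG : ∀ y : ℝ, y ≠ 0 → ‖f y‖ₑ ^ 2 = G y ^ 2 * ENNReal.ofReal |y| := by
    intro y hy
    have hy' : 0 < |y| := abs_pos.2 hy
    have : ENNReal.ofReal (|y| ^ (-(1/2):ℝ)) ^ 2 * ENNReal.ofReal |y| = 1 := by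
      rw [← ENNReal.ofReal_pow (by positivity), ← ENNReal.ofReal_mul (by positivity),
        ← Real.rpow_mul_natCast hy'.le]
      norm_num [Real.rpow_neg_one, hy]
    rw [hGdef]
    try dsimp only
    rw [mul_pow, mul_assoc, this, mul_one]
  have key : ‖T f‖ₑ ^ 2 ≤ ENNReal.ofReal A ^ 2 * Q := by
    refine (enorm_bound ht0 hT f).trans ?_
    calc _ ≤ ∫⁻ x, ENNReal.ofReal A * ∫⁻ u in Set.Ioo (0:ℝ) 1,
            kk t u ^ 2 * ENNReal.ofReal u * G (u * x) := by
          refine lintegral_mono_ae ?_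
          filter_upwards [Measure.ae_ne volume (0:ℝ)] with x hx
          have hx' : 0 < |x| := abs_pos.2 hx
          have hmx : Measurable fun u => G (u * x) := hmG.comp (measurable_mul_const x)
          have hcs := cs_lintegral (μ := volume.restrict (Set.Ioo (0:ℝ) 1))
            (c := fun u => kk t u * ‖f (u * x)‖ₑ) (p := fun u => G (u * x))
            (q := fun u => ENNReal.ofReal |x| * (kk t u ^ 2 * ENNReal.ofReal u * G (u * x)))
            hmx.aemeasurable (by fun_prop) (by
              refine (ae_restrict_iff' measurableSet_Ioo).2 (Eventually.of_forall fun u hu => ?_)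
              have hu0 := hu.1
              rw [mul_pow, hFG _ (mul_ne_zero hu0.ne' hx), abs_mul,
                ENNReal.ofReal_mul (abs_nonneg _), abs_of_pos hu0]
              apply le_of_eq
              ring)
          refine hcs.trans ?_
          have h1 : ∫⁻ u in Set.Ioo (0:ℝ) 1, G (u * x) ≤ ENNReal.ofReal |x⁻¹| * ENNReal.ofReal A := by
            refine (setLIntegral_le_lintegral _ _).trans ?_
            simp_rw [mul_comm _ x]
            rw [scale_lintegral hmG hx, hA]
          rw [lintegral_const_mul _ (by fun_prop)]
          refine (mul_le_mul_left h1 _).trans (le_of_eq ?_)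
          have : ENNReal.ofReal |x⁻¹| * ENNReal.ofReal |x| = 1 := by
            rw [← ENNReal.ofReal_mul (abs_nonneg _), ← abs_mul, inv_mul_cancel₀ hx]
            simp
          rw [mul_mul_mul_comm, this, one_mul]
      _ = ENNReal.ofReal A * ∫⁻ u in Set.Ioo (0:ℝ) 1, ∫⁻ x,
            kk t u ^ 2 * ENNReal.ofReal u * G (u * x) := by
          have hm : Measurable (Function.uncurry fun x u : ℝ =>
              kk t u ^ 2 * ENNReal.ofReal u * G (u * x)) := by
            have : Measurable fun z : ℝ × ℝ => G (z.2 * z.1) :=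
              hmG.comp (measurable_snd.mul measurable_fst)
            unfold Function.uncurry
            fun_prop
          rw [lintegral_const_mul _ (Measurable.lintegral_prod_right hm),
            lintegral_lintegral_swap hm.aemeasurable]
      _ = ENNReal.ofReal A * ∫⁻ u in Set.Ioo (0:ℝ) 1, kk t u ^ 2 * ENNReal.ofReal A := by
          congr 1
          refine setLIntegral_congr_fun measurableSet_Ioo fun u hu => ?_
          have hu0 := hu.1
          try dsimp only
          rw [lintegral_const_mul (f := fun x => G (u * x)) _ (hmG.comp (measurable_const_mul u)),
            scale_lintegral hmG hu0.ne', hA, ← mul_assoc, mul_assoc (kk t u ^ 2),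
            ← ENNReal.ofReal_mul (by positivity), abs_of_pos (by positivity),
            mul_inv_cancel₀ hu0.ne', ENNReal.ofReal_one, mul_one]
      _ = _ := by
          rw [lintegral_mul_const _ (by fun_prop), ← hQ]
          ring
  rw [hQv, ← ofReal_norm, ← ENNReal.ofReal_pow (by positivity),
    ← ENNReal.ofReal_pow hA0, ← ENNReal.ofReal_mul (by positivity)] at key
  exact (ENNReal.ofReal_le_ofReal_iff (by positivity)).1 key

lemma gamma_ratio {t : ℝ} (ht : 1 < t) :
    ((2:ℝ) ^ (-t)) ^ 2 * (Real.Gamma (2 * t - 1) / Real.Gamma t ^ 2) ≤ (√t)⁻¹ := by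
  have ht0 : 0 < t := by linarith
  have hG := Real.Gamma_pos_of_pos ht0
  have hG2 := Real.Gamma_pos_of_pos (show 0 < 2 * t - 1 by linarith)
  have h1 := Real.Gamma_mul_Gamma_add_half_of_pos ht0
  have h2 : Real.Gamma (2 * t) = (2 * t - 1) * Real.Gamma (2 * t - 1) := by
    have := Real.Gamma_add_one (show 2 * t - 1 ≠ 0 by linarith)
    rwa [sub_add_cancel] at this
  have h3 : Real.Gamma (t + 1/2) ≤ Real.Gamma t * √t := by
    have := Real.Gamma_mul_add_mul_le_rpow_Gamma_mul_rpow_Gamma ht0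
      (show 0 < t + 1 by linarith) (show (0:ℝ) < 1/2 by norm_num) (show (0:ℝ) < 1/2 by norm_num)
      (by norm_num)
    rw [Real.Gamma_add_one ht0.ne', show 1/2 * t + 1/2 * (t+1) = t + 1/2 by ring,
      ← Real.sqrt_eq_rpow, ← Real.sqrt_eq_rpow, Real.sqrt_mul ht0.le, mul_left_comm,
      Real.mul_self_sqrt hG.le] at this
    linarith
  have h4 : (2:ℝ) ^ (1 - 2 * t) = 2 * ((2:ℝ) ^ (-t)) ^ 2 := by
    rw [← Real.rpow_mul_natCast (by norm_num), show 1 - 2 * t = 1 + -t * (2:ℕ) by push_cast; ring,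
      Real.rpow_add (by norm_num), Real.rpow_one]
  rw [h2, h4] at h1
  set c := ((2:ℝ) ^ (-t)) ^ 2 with hc
  have hc0 : 0 ≤ c := by positivity
  have hpi : 1 ≤ √Real.pi := by
    rw [Real.one_le_sqrt]; linarith [Real.pi_gt_three]
  have hs : 0 < √t := Real.sqrt_pos.2 ht0
  have hss : √t * √t = t := Real.mul_self_sqrt ht0.le
  rw [← mul_div_assoc, div_le_iff₀ (by positivity), inv_mul_eq_div, le_div_iff₀ hs]
  have h5 : (2 * t - 1) * (c * Real.Gamma (2 * t - 1)) * 2 ≤ Real.Gamma t ^ 2 * √t := by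
    calc _ = (2 * t - 1) * (c * Real.Gamma (2 * t - 1)) * 2 * 1 := by ring
      _ ≤ (2 * t - 1) * (c * Real.Gamma (2 * t - 1)) * 2 * √Real.pi := by
        have : 0 ≤ 2 * t - 1 := by linarith
        gcongr
      _ = Real.Gamma t * Real.Gamma (t + 1/2) := by rw [h1]; ring
      _ ≤ _ := by rw [sq, mul_assoc]; gcongr
  have h6 : t * (c * Real.Gamma (2 * t - 1)) ≤ Real.Gamma t ^ 2 * √t := by
    refine le_trans ?_ h5
    have : 0 ≤ c * Real.Gamma (2 * t - 1) := by positivity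
    nlinarith
  nlinarith

lemma approx (f : L2) {ε : ℝ} (hε : 0 < ε) : ∃ g : L2, ‖f - g‖ ≤ ε ∧ ∃ A : ℝ, 0 ≤ A ∧
    ∫⁻ y, ‖g y‖ₑ * ENNReal.ofReal (|y| ^ (-(1/2):ℝ)) = ENNReal.ofReal A := by
  obtain ⟨g, hgc, hfg, hgcont, hgm⟩ := (Lp.memLp f).exists_hasCompactSupport_eLpNorm_sub_le
    (by simp) (ε := ENNReal.ofReal ε) (by simpa using hε)
  refine ⟨hgm.toLp g, ?_, ?_⟩
  · have : ‖f - hgm.toLp g‖ₑ ≤ ENNReal.ofReal ε := by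
      rw [Lp.enorm_def]
      refine le_trans (le_of_eq (eLpNorm_congr_ae ?_)) hfg
      filter_upwards [Lp.coeFn_sub f (hgm.toLp g), hgm.coeFn_toLp] with x h1 h2
      rw [h1, Pi.sub_apply, Pi.sub_apply, h2]
    rw [← ofReal_norm] at this
    exact (ENNReal.ofReal_le_ofReal_iff hε.le).1 this
  · have hloc : LocallyIntegrable (fun y : ℝ => |y| ^ (-(1/2):ℝ)) volume := by
      refine locallyIntegrable_of_norm_le_rpow (C := 1) (α := 1/2) (by simp) ?_ ?_ ?_
      · norm_num
      · exact Eventually.of_forall fun y => by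
          rw [Real.norm_of_nonneg (by positivity), Real.norm_eq_abs, one_mul]
      · exact Measurable.aestronglyMeasurable (by fun_prop)
    have hint : Integrable (fun y : ℝ => |y| ^ (-(1/2):ℝ) • g y) volume :=
      hloc.integrable_smul_right_of_hasCompactSupport hgcont hgc
    have hlt := hint.2
    refine ⟨(∫⁻ y, ‖(hgm.toLp g) y‖ₑ * ENNReal.ofReal (|y| ^ (-(1/2):ℝ))).toReal,
      ENNReal.toReal_nonneg, (ENNReal.ofReal_toReal (ne_of_lt ?_)).symm⟩
    refine lt_of_eq_of_lt (lintegral_congr_ae ?_) hlt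
    filter_upwards [hgm.coeFn_toLp] with y hy
    rw [hy, enorm_smul, mul_comm, ← ofReal_norm (|y| ^ _), Real.norm_of_nonneg (by positivity)]

/-- For every `f ∈ L²(ℝ)`, `2^{-t} ‖H_t f‖ → 0` as `t → +∞`,
where `H_t` is the Hölder operator of order `t > 0`; i.e. the semigroup
`T(t) = 2^{-t} H_t` is uniformly stable. -/
theorem stmt10
    (H : ℝ → (L2 →L[ℂ] L2))
    (hHdef : ∀ t : ℝ, 0 < t → IsHausdorffOp (holderKernel (t : ℂ)) (H t)) :
    ∀ f : L2, Filter.Tendsto (fun t : ℝ => (2 : ℝ) ^ (-t) * ‖H t f‖)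
      Filter.atTop (nhds 0) := by
  intro f
  rw [Metric.tendsto_nhds]
  intro ε hε
  obtain ⟨g, hfg, A, hA0, hA⟩ := approx f (half_pos hε)
  have hlim : Tendsto (fun t : ℝ => A ^ 2 * (√t)⁻¹) atTop (nhds 0) := by
    simpa using (tendsto_inv_atTop_zero.comp Real.tendsto_sqrt_atTop).const_mul (A ^ 2)
  have hev := hlim.eventually (gt_mem_nhds (show (0:ℝ) < (ε/2)^2 by positivity))
  filter_upwards [hev, eventually_gt_atTop 1] with t h1 ht
  have ht0 : 0 < t := by linarith
  have hT := hHdef t ht0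
  have b1 := bound_one ht0 hT (f - g)
  have b2 := bound_two ht hT g hA0 hA
  have b3 := gamma_ratio ht
  have hp : (0:ℝ) < 2 ^ (-t) := by positivity
  have hpp : (2:ℝ) ^ (-t) * 2 ^ t = 1 := by
    rw [← Real.rpow_add (by norm_num)]; simp
  have c2 : (2:ℝ) ^ (-t) * ‖H t g‖ < ε / 2 := by
    refine lt_of_pow_lt_pow_left₀ 2 (by positivity) (lt_of_le_of_lt ?_ h1)
    rw [mul_pow]
    calc _ ≤ ((2:ℝ) ^ (-t)) ^ 2 * (A ^ 2 * (Real.Gamma (2 * t - 1) / Real.Gamma t ^ 2)) := by gcongr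
      _ = A ^ 2 * (((2:ℝ) ^ (-t)) ^ 2 * (Real.Gamma (2 * t - 1) / Real.Gamma t ^ 2)) := by ring
      _ ≤ _ := by gcongr
  have c1 : (2:ℝ) ^ (-t) * ‖H t (f - g)‖ ≤ ε / 2 := by
    calc _ ≤ (2:ℝ) ^ (-t) * (2 ^ t * ‖f - g‖) := by gcongr
      _ = ‖f - g‖ := by rw [← mul_assoc, hpp, one_mul]
      _ ≤ _ := hfg
  have hsum : ‖H t f‖ ≤ ‖H t (f - g)‖ + ‖H t g‖ := by
    have : H t f = H t (f - g) + H t g := by rw [← map_add, sub_add_cancel]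
    rw [this]; exact norm_add_le _ _
  rw [Real.dist_eq, sub_zero, abs_of_nonneg (by positivity)]
  calc _ ≤ (2:ℝ) ^ (-t) * (‖H t (f - g)‖ + ‖H t g‖) := by gcongr
    _ < ε := by rw [mul_add]; linarith
end
end
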